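/- Let E be a finite field of odd cardinality. Then every 4-dimensional regular quadratic form over E(X) which is isotropic over the completion E(X)_v for every v ∈ Ω_{E(X)/E} is isotropic over E(X). -/

import Mathlib

open Polynomial

/-- `f` is square-reflexive over `E`. -/
def IsSquareReflexive {E : Type*} [Field E] (f : Polynomial E) : Prop :=
  Squarefree f ∧
  ∀ α : (Polynomial E ⧸ Ideal.span {f})ˣ,
    (∃ u : Eˣ, Algebra.norm E (α : Polynomial E ⧸ Ideal.span {f}) = (u : E) ^ 2 ∨
               Algebra.norm E (α : Polynomial E ⧸ Ideal.span {f}) = f.leadingCoeff * (u : E) ^ 2) →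
    ∃ g : Polynomial E, IsCoprime f g ∧
      (∃ β : (Polynomial E ⧸ Ideal.span {f})ˣ,
        Ideal.Quotient.mk (Ideal.span {f}) g
          = (α : Polynomial E ⧸ Ideal.span {f}) * (β : Polynomial E ⧸ Ideal.span {f}) ^ 2) ∧
      IsSquare (Ideal.Quotient.mk (Ideal.span {g}) f)

/-- Isotropy of the diagonal quadratic form `⟨a 0, …, a (n-1)⟩`. -/
def IsotropicDiag {R : Type*} [CommRing R] {n : ℕ} (a : Fin n → R) : Prop :=
  ∃ x : Fin n → R, x ≠ 0 ∧ ∑ i, a i * x i ^ 2 = 0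

/-- `v` is a ℤ-valuation on `E(X)` (i.e. a valuation with value group exactly ℤ)
which is trivial on `E`. -/
def IsZValuationTrivialOnBase (E : Type*) [Field E]
    (v : Valuation (RatFunc E) (WithZero (Multiplicative ℤ))) : Prop :=
  Function.Surjective v ∧ ∀ a : Eˣ, v (algebraMap E (RatFunc E) a) = 1

/-- The diagonal form `⟨a 0, …, a (n-1)⟩` is isotropic over the completion of `F`
at the ℤ-valuation `v`. -/
noncomputable def IsotropicCompletion {F : Type*} [Field F]
    (v : Valuation F (WithZero (Multiplicative ℤ))) {n : ℕ} (a : Fin n → F) : Prop :=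
  letI : Valued F (WithZero (Multiplicative ℤ)) := Valued.mk' v
  IsotropicDiag (fun i => UniformSpace.Completion.coe' (a i))

open Classical in
/-- The quadratic residue symbol of `x` modulo `p`, with values in `{0, 1, -1}`. -/
noncomputable def quadSymbol {E : Type*} [Field E] (p x : E[X]) : ℤ :=
  if p ∣ x then 0 else if ∃ y, p ∣ x - y ^ 2 then 1 else -1

section QuadSymbol

variable {E : Type*} [Field E] {p x y : E[X]}

theorem quadSymbol_eq_zero_iff : quadSymbol p x = 0 ↔ p ∣ x := by
  unfold quadSymbol
  split_ifs <;> simp_all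

theorem quadSymbol_eq_one_or_neg_one (h : ¬ p ∣ x) : quadSymbol p x = 1 ∨ quadSymbol p x = -1 := by
  unfold quadSymbol
  split_ifs <;> simp

theorem quadSymbol_mul_self (h : ¬ p ∣ x) : quadSymbol p x * quadSymbol p x = 1 := by
  rcases quadSymbol_eq_one_or_neg_one h with h | h <;> simp [h]

theorem quadSymbol_congr (h : p ∣ x - y) : quadSymbol p x = quadSymbol p y := by
  have h1 : p ∣ x ↔ p ∣ y := by
    constructor
    · intro hx; simpa using dvd_sub hx h
    · intro hy; simpa using dvd_add h hy
  have h2 : (∃ z, p ∣ x - z ^ 2) ↔ ∃ z, p ∣ y - z ^ 2 := by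
    constructor
    · rintro ⟨z, hz⟩
      exact ⟨z, by have := dvd_sub hz h; ring_nf at this ⊢; exact this⟩
    · rintro ⟨z, hz⟩
      exact ⟨z, by have := dvd_add hz h; ring_nf at this ⊢; exact this⟩
  classical
  exact if_congr h1 rfl (if_congr h2 rfl rfl)

theorem quadSymbol_eq_one_of_dvd (h : ¬ p ∣ x) (h' : p ∣ x - y ^ 2) : quadSymbol p x = 1 := by
  unfold quadSymbol
  rw [if_neg h, if_pos ⟨y, h'⟩]

theorem exists_dvd_sub_sq_of_quadSymbol (h : quadSymbol p x = 1) : ∃ y, p ∣ x - y ^ 2 := by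
  unfold quadSymbol at h
  by_contra h2
  rw [if_neg h2] at h
  split_ifs at h
  simp at h

theorem quadSymbol_sq (h : ¬ p ∣ x ^ 2) : quadSymbol p (x ^ 2) = 1 :=
  quadSymbol_eq_one_of_dvd h (y := x) (by simp)

theorem quadSymbol_eq_quadraticChar [Fact (Irreducible p)] [Fintype (AdjoinRoot p)]
    [DecidableEq (AdjoinRoot p)] :
    quadSymbol p x = quadraticChar (AdjoinRoot p) (AdjoinRoot.mk p x) := by
  have h1 : (∃ y, p ∣ x - y ^ 2) ↔ IsSquare (AdjoinRoot.mk p x) := by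
    constructor
    · rintro ⟨y, hy⟩
      exact ⟨AdjoinRoot.mk p y, by rw [← map_mul, ← pow_two]; exact AdjoinRoot.mk_eq_mk.2 hy⟩
    · rintro ⟨z, hz⟩
      obtain ⟨y, rfl⟩ := AdjoinRoot.mk_surjective z
      exact ⟨y, AdjoinRoot.mk_eq_mk.1 (by rw [hz, ← map_mul, pow_two])⟩
  classical
  exact if_congr AdjoinRoot.mk_eq_zero.symm rfl (if_congr h1 rfl rfl)

theorem quadSymbol_one (hp : Irreducible p) : quadSymbol p 1 = 1 := by
  simpa using quadSymbol_sq (p := p) (x := 1) (by simpa using hp.not_dvd_one)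

theorem ringChar_adjoinRoot [Fact (Irreducible p)] : ringChar (AdjoinRoot p) = ringChar E :=
  (Algebra.ringChar_eq E (AdjoinRoot p)).symm

variable [Fintype E]

theorem finite_adjoinRoot (hp : p ≠ 0) : Finite (AdjoinRoot p) := by
  have : Module.Finite E (AdjoinRoot p) := (AdjoinRoot.powerBasis hp).finite
  exact Module.finite_of_finite E

theorem quadSymbol_mul (hp : Irreducible p) (x y : E[X]) :
    quadSymbol p (x * y) = quadSymbol p x * quadSymbol p y := by
  classical
  have : Fact (Irreducible p) := ⟨hp⟩
  have := finite_adjoinRoot hp.ne_zero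
  have := Fintype.ofFinite (AdjoinRoot p)
  simp only [quadSymbol_eq_quadraticChar, map_mul]

theorem exists_quadSymbol_eq_neg_one (hE : ringChar E ≠ 2) (hp : Irreducible p) :
    ∃ x, quadSymbol p x = -1 := by
  classical
  have : Fact (Irreducible p) := ⟨hp⟩
  have := finite_adjoinRoot hp.ne_zero
  have := Fintype.ofFinite (AdjoinRoot p)
  obtain ⟨a, ha⟩ := quadraticChar_exists_neg_one (F := AdjoinRoot p)
    (by rwa [ringChar_adjoinRoot])
  obtain ⟨x, rfl⟩ := AdjoinRoot.mk_surjective a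
  exact ⟨x, by rw [quadSymbol_eq_quadraticChar, ha]⟩

theorem norm_adjoinRoot_mk [Fact (Irreducible p)] (hm : p.Monic) (x : E[X]) :
    Algebra.norm E (AdjoinRoot.mk p x) = p.resultant x := by
  have hp : Irreducible p := Fact.out
  let L := AlgebraicClosure E
  have : Module.Finite E (AdjoinRoot p) := (AdjoinRoot.powerBasis hp.ne_zero).finite
  have hsep : p.Separable := PerfectField.separable_of_irreducible hp
  apply (algebraMap E L).injective
  rw [Algebra.norm_eq_prod_embeddings, ← resultant_map_map]
  have hr := resultant_eq_prod_eval (p.map (algebraMap E L)) (x.map (algebraMap E L)) x.natDegree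
    natDegree_map_le (IsAlgClosed.splits _)
  rw [natDegree_map] at hr
  rw [hr, (hm.map _).leadingCoeff, one_pow, one_mul]
  have hnd : (p.aroots L).Nodup := nodup_roots (hsep.map)
  classical
  have key : ∀ σ : AdjoinRoot p →ₐ[E] L, σ (AdjoinRoot.mk p x)
      = eval (AdjoinRoot.equiv L E p hp.ne_zero σ : L) (x.map (algebraMap E L)) := by
    intro σ
    have h1 : (AdjoinRoot.equiv L E p hp.ne_zero σ : L) = σ (AdjoinRoot.root p) := rfl
    rw [h1, eval_map_algebraMap, ← AdjoinRoot.aeval_eq, aeval_algHom_apply]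
  simp_rw [key]
  rw [(AdjoinRoot.equiv L E p hp.ne_zero).prod_comp
    (fun a => eval (a : L) (x.map (algebraMap E L)))]
  have h2 : ∏ a : {a // a ∈ p.aroots L}, eval (a : L) (x.map (algebraMap E L))
      = ∏ a ∈ (p.aroots L).toFinset, eval (a : L) (x.map (algebraMap E L)) := by
    rw [Finset.prod_subtype (p.aroots L).toFinset (p := fun a => a ∈ p.aroots L) (by simp)]
  rw [h2, Finset.prod, Multiset.toFinset_val, Multiset.dedup_eq_self.2 hnd]

variable [DecidableEq E]

theorem quadSymbol_eq_quadraticChar_resultant (hE : ringChar E ≠ 2) (hp : Irreducible p)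
    (hm : p.Monic) (x : E[X]) : quadSymbol p x = quadraticChar E (p.resultant x) := by
  classical
  have : Fact (Irreducible p) := ⟨hp⟩
  have := finite_adjoinRoot hp.ne_zero
  have := Fintype.ofFinite (AdjoinRoot p)
  have hF : ringChar (AdjoinRoot p) ≠ 2 := by rwa [ringChar_adjoinRoot]
  rw [quadSymbol_eq_quadraticChar, ← norm_adjoinRoot_mk hm]
  set a := AdjoinRoot.mk p x
  have h0 : ((quadraticChar (AdjoinRoot p) a : ℤ) : AdjoinRoot p)
      = ((quadraticChar E (Algebra.norm E a) : ℤ) : AdjoinRoot p) := by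
    rw [quadraticChar_eq_pow_of_char_ne_two' hF]
    have h1 := congrArg (algebraMap E (AdjoinRoot p))
      (quadraticChar_eq_pow_of_char_ne_two' hE (Algebra.norm E a))
    rw [map_intCast] at h1
    rw [h1, map_pow, FiniteField.algebraMap_norm_eq_pow, ← pow_mul]
    congr 1
    simp only [← Fintype.card_eq_nat_card]
    have h2 := FiniteField.odd_card_of_char_ne_two hE
    have h3 := FiniteField.odd_card_of_char_ne_two hF
    have h4 : Fintype.card E - 1 ∣ Fintype.card (AdjoinRoot p) - 1 := by
      rw [Module.card_eq_pow_finrank (K := E) (V := AdjoinRoot p)]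
      simpa using Nat.sub_dvd_pow_sub_pow (Fintype.card E) 1 (Module.finrank E (AdjoinRoot p))
    have h5 := Fintype.one_lt_card (α := E)
    obtain ⟨k, hk⟩ := h4
    rw [hk, Nat.mul_div_cancel_left _ (by omega)]
    obtain ⟨j, hj⟩ : ∃ j, Fintype.card E = 2 * j + 1 := ⟨Fintype.card E / 2, by omega⟩
    have h6 : Fintype.card (AdjoinRoot p) = 2 * (j * k) + 1 := by
      have : 0 < Fintype.card (AdjoinRoot p) := Fintype.card_pos
      rw [hj] at hk
      have h7 : (2 * j + 1 - 1) * k = 2 * (j * k) := by simp [mul_assoc]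
      omega
    have h8 : Fintype.card E / 2 = j := by omega
    have h9 : Fintype.card (AdjoinRoot p) / 2 = j * k := by omega
    rw [h8, h9, mul_comm]
  have hd : ∀ {F : Type _} [Field F] [Fintype F] [DecidableEq F] (b : F),
      quadraticChar F b ∈ ({0, 1, -1} : Set ℤ) := by
    intro F _ _ _ b
    rcases eq_or_ne b 0 with rfl | hb
    · simp
    · rcases quadraticChar_dichotomy hb with h | h <;> simp [h]
  exact Int.cast_injOn_of_ringChar_ne_two hF
    (by have := hd a; simpa [or_comm] using this)
    (by have := hd (Algebra.norm E a); simpa [or_comm] using this) h0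

theorem quadSymbol_C (hE : ringChar E ≠ 2) (hp : Irreducible p) (hm : p.Monic) (c : E) :
    quadSymbol p (C c) = quadraticChar E c ^ p.natDegree := by
  rw [quadSymbol_eq_quadraticChar_resultant hE hp hm, resultant_C_right, natDegree_C, pow_zero,
    one_mul, map_pow]

theorem quadSymbol_neg_one (hE : ringChar E ≠ 2) (hp : Irreducible p) (hm : p.Monic) :
    quadSymbol p (-1) = quadraticChar E (-1) ^ p.natDegree := by
  simpa using quadSymbol_C hE hp hm (-1)

theorem quadSymbol_reciprocity (hE : ringChar E ≠ 2) {r : E[X]} (hp : Irreducible p) (hm : p.Monic)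
    (hr : Irreducible r) (hrm : r.Monic) (hne : p ≠ r) :
    quadSymbol p r * quadSymbol r p = quadraticChar E (-1) ^ (p.natDegree * r.natDegree) := by
  have h1 : quadSymbol p r =
      quadraticChar E (-1) ^ (p.natDegree * r.natDegree) * quadSymbol r p := by
    rw [quadSymbol_eq_quadraticChar_resultant hE hp hm,
      quadSymbol_eq_quadraticChar_resultant hE hr hrm, resultant_comm, map_mul, map_pow]
  rw [h1, mul_assoc, quadSymbol_mul_self, mul_one]
  intro h
  exact hne (eq_of_monic_of_associated hrm hm (hr.associated_of_dvd hp h)).symm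

end QuadSymbol

/-- The tame Hilbert symbol of `x` and `y` at the irreducible polynomial `p`. -/
noncomputable def tameSymbol {E : Type*} [Field E] (p x y : E[X]) : ℤ :=
  quadSymbol p (-1) ^ (multiplicity p x * multiplicity p y) *
    quadSymbol p (x / p ^ multiplicity p x) ^ multiplicity p y *
    quadSymbol p (y / p ^ multiplicity p y) ^ multiplicity p x

/-- The tame Hilbert symbol of `x` and `y` at the infinite place. -/
noncomputable def tameSymbolInfty {E : Type*} [Field E] [Fintype E] [DecidableEq E]
    (x y : E[X]) : ℤ :=
  quadraticChar E (-1) ^ (x.natDegree * y.natDegree) *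
    quadraticChar E x.leadingCoeff ^ y.natDegree * quadraticChar E y.leadingCoeff ^ x.natDegree

section TameSymbol

variable {E : Type*} [Field E] {p x y z : E[X]}

theorem exists_eq_pow_mul_not_dvd (hp : Irreducible p) (hx : x ≠ 0) :
    ∃ (n : ℕ) (x' : E[X]), x = p ^ n * x' ∧ ¬ p ∣ x' :=
  ⟨_, (FiniteMultiplicity.of_prime_left hp.prime hx).exists_eq_pow_mul_and_not_dvd⟩

theorem tameSymbol_eq (hp : Irreducible p) {n m : ℕ} {x y : E[X]} (hx : ¬ p ∣ x) (hy : ¬ p ∣ y) :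
    tameSymbol p (p ^ n * x) (p ^ m * y) =
      quadSymbol p (-1) ^ (n * m) * quadSymbol p x ^ m * quadSymbol p y ^ n := by
  have key : ∀ (k : ℕ) (w : E[X]), ¬ p ∣ w → multiplicity p (p ^ k * w) = k := by
    intro k w hw
    apply multiplicity_eq_of_dvd_of_not_dvd (dvd_mul_right _ _)
    rw [pow_succ]
    intro h
    exact hw ((mul_dvd_mul_iff_left (pow_ne_zero k hp.ne_zero)).1 h)
  unfold tameSymbol
  rw [key n x hx, key m y hy, mul_div_cancel_left₀ _ (pow_ne_zero _ hp.ne_zero),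
    mul_div_cancel_left₀ _ (pow_ne_zero _ hp.ne_zero)]

theorem not_dvd_neg_one (hp : Irreducible p) : ¬ p ∣ (-1 : E[X]) := by
  rw [dvd_neg]; exact hp.not_dvd_one

theorem tameSymbol_comm (p x y : E[X]) : tameSymbol p x y = tameSymbol p y x := by
  unfold tameSymbol
  rw [mul_comm (multiplicity p x)]; ring

theorem tameSymbol_eq_one_of_not_dvd (hp : Irreducible p) (hx : ¬ p ∣ x) (hy : ¬ p ∣ y) :
    tameSymbol p x y = 1 := by
  simpa using tameSymbol_eq hp (n := 0) (m := 0) hx hy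

theorem tameSymbol_mul_self (hp : Irreducible p) (hx : x ≠ 0) (hy : y ≠ 0) :
    tameSymbol p x y * tameSymbol p x y = 1 := by
  obtain ⟨n, x, rfl, hx'⟩ := exists_eq_pow_mul_not_dvd hp hx
  obtain ⟨m, y, rfl, hy'⟩ := exists_eq_pow_mul_not_dvd hp hy
  rw [tameSymbol_eq hp hx' hy']
  have h1 := quadSymbol_mul_self (not_dvd_neg_one hp)
  have h2 := quadSymbol_mul_self hx'
  have h3 := quadSymbol_mul_self hy'
  calc _ = (quadSymbol p (-1) * quadSymbol p (-1)) ^ (n * m) * (quadSymbol p x * quadSymbol p x) ^ m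
        * (quadSymbol p y * quadSymbol p y) ^ n := by ring
    _ = 1 := by rw [h1, h2, h3]; simp

theorem pow_eq_pow_of_mod_two {a : ℤ} (h : a * a = 1) {n m : ℕ} (hnm : n % 2 = m % 2) :
    a ^ n = a ^ m := by
  rw [← Nat.div_add_mod n 2, ← Nat.div_add_mod m 2, hnm, pow_add, pow_add, pow_mul, pow_mul,
    pow_two, h, one_pow, one_pow]

/-- The tame symbol depends only on the local square class. -/
theorem tameSymbol_congr (hp : Irreducible p) {n m : ℕ} {x y z : E[X]} (hx : ¬ p ∣ x)
    (hy : ¬ p ∣ y) (hz : z ≠ 0) (hnm : n % 2 = m % 2) (h : quadSymbol p x = quadSymbol p y) :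
    tameSymbol p z (p ^ n * x) = tameSymbol p z (p ^ m * y) := by
  obtain ⟨k, z, rfl, hz'⟩ := exists_eq_pow_mul_not_dvd hp hz
  rw [tameSymbol_eq hp hz' hx, tameSymbol_eq hp hz' hy, h,
    pow_eq_pow_of_mod_two (quadSymbol_mul_self hz') hnm,
    pow_eq_pow_of_mod_two (quadSymbol_mul_self (not_dvd_neg_one hp)) (n := k * n) (m := k * m)
      (by rw [Nat.mul_mod, hnm, ← Nat.mul_mod])]

theorem tameSymbol_eq_of_pow_dvd_sub (hp : Irreducible p) (hx : x ≠ 0) (hz : z ≠ 0)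
    (h : p ^ (multiplicity p x + 1) ∣ x - y) : tameSymbol p z x = tameSymbol p z y := by
  obtain ⟨x', hx1, hx'⟩ :=
    (FiniteMultiplicity.of_prime_left hp.prime hx).exists_eq_pow_mul_and_not_dvd
  set n := multiplicity p x
  obtain ⟨w, hw⟩ := h
  have hy : y = p ^ n * (x' - p * w) := by
    have : y = x - p ^ (n + 1) * w := by rw [← hw]; ring
    rw [this]; nth_rewrite 1 [hx1]; ring
  have hd : p ∣ x' - (x' - p * w) := ⟨w, by ring⟩
  have hy' : ¬ p ∣ x' - p * w := fun h' => hx' (by simpa using dvd_add hd h')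
  rw [hx1, hy]
  exact tameSymbol_congr hp hx' hy' hz rfl (quadSymbol_congr hd)

theorem even_of_pow_mul_eq_sq (hp : Irreducible p) {n : ℕ} {x s : E[X]} (hx : ¬ p ∣ x)
    (h : p ^ n * x = s ^ 2) : ∃ (k : ℕ) (r : E[X]), n = 2 * k ∧ x = r ^ 2 := by
  have hs : s ≠ 0 := by
    rintro rfl
    have : p ^ n * x = 0 := by simpa using h
    rcases mul_eq_zero.1 this with h1 | h1
    · exact pow_ne_zero n hp.ne_zero h1
    · exact hx (h1 ▸ dvd_zero p)
  obtain ⟨k, r, rfl, hr⟩ := exists_eq_pow_mul_not_dvd hp hs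
  have hr2 : ¬ p ∣ r ^ 2 := fun h' => hr (hp.prime.dvd_of_dvd_pow h')
  have h' : p ^ n * x = p ^ (2 * k) * r ^ 2 := by rw [h]; ring
  have h0 : p ≠ 0 := hp.ne_zero
  rcases lt_trichotomy n (2 * k) with hlt | heq | hgt
  · exfalso
    obtain ⟨j, hj⟩ := Nat.exists_eq_add_of_lt hlt
    rw [hj, show n + j + 1 = n + (j + 1) by ring, pow_add, mul_assoc] at h'
    have := mul_left_cancel₀ (pow_ne_zero n h0) h'
    exact hx (this ▸ Dvd.dvd.mul_right (dvd_pow_self p (by simp)) _)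
  · exact ⟨k, r, heq, by rw [heq] at h'; exact mul_left_cancel₀ (pow_ne_zero _ h0) h'⟩
  · exfalso
    obtain ⟨j, hj⟩ := Nat.exists_eq_add_of_lt hgt
    rw [hj, show 2 * k + j + 1 = 2 * k + (j + 1) by ring, pow_add, mul_assoc] at h'
    have := mul_left_cancel₀ (pow_ne_zero _ h0) h'
    exact hr2 (this ▸ Dvd.dvd.mul_right (dvd_pow_self p (by simp)) _)

/-- The Steinberg relation, when the first argument has smaller order. -/
theorem tameSymbol_steinberg_of_lt (hp : Irreducible p) {n m : ℕ} {x y s : E[X]} (hx : ¬ p ∣ x)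
    (hy : ¬ p ∣ y) (hnm : n < m) (h : p ^ n * x + p ^ m * y = s ^ 2) :
    tameSymbol p (p ^ n * x) (p ^ m * y) = 1 := by
  obtain ⟨j, rfl⟩ := Nat.exists_eq_add_of_lt hnm
  have h1 : p ^ n * (x + p * (p ^ j * y)) = s ^ 2 := by rw [← h]; ring
  have hd : ¬ p ∣ x + p * (p ^ j * y) := fun h' => hx ((dvd_add_left (dvd_mul_right _ _)).1 h')
  obtain ⟨k, r, hk, hr⟩ := even_of_pow_mul_eq_sq hp hd h1
  have hxr : quadSymbol p x = 1 := quadSymbol_eq_one_of_dvd hx (y := r)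
    ⟨-(p ^ j * y), by rw [← hr]; ring⟩
  have h2 : ∀ a : ℤ, a * a = 1 → a ^ n = 1 := by
    intro a ha; rw [hk, pow_mul, pow_two, ha, one_pow]
  rw [tameSymbol_eq hp hx hy, hxr, pow_mul, h2 _ (quadSymbol_mul_self hy),
    h2 _ (quadSymbol_mul_self (not_dvd_neg_one hp))]
  simp

variable [Fintype E]

theorem tameSymbol_mul_right (hp : Irreducible p) (hx : x ≠ 0) (hy : y ≠ 0) (hz : z ≠ 0) :
    tameSymbol p x (y * z) = tameSymbol p x y * tameSymbol p x z := by
  obtain ⟨n, x, rfl, hx'⟩ := exists_eq_pow_mul_not_dvd hp hx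
  obtain ⟨m, y, rfl, hy'⟩ := exists_eq_pow_mul_not_dvd hp hy
  obtain ⟨k, z, rfl, hz'⟩ := exists_eq_pow_mul_not_dvd hp hz
  have h : p ^ m * y * (p ^ k * z) = p ^ (m + k) * (y * z) := by ring
  have hyz : ¬ p ∣ y * z := fun h => (hp.prime.dvd_or_dvd h).elim hy' hz'
  rw [h, tameSymbol_eq hp hx' hy', tameSymbol_eq hp hx' hz', tameSymbol_eq hp hx' hyz,
    quadSymbol_mul hp]
  ring

theorem tameSymbol_mul_sq_right (hp : Irreducible p) (hx : x ≠ 0) (hy : y ≠ 0) (hz : z ≠ 0) :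
    tameSymbol p x (y * z ^ 2) = tameSymbol p x y := by
  rw [tameSymbol_mul_right hp hx hy (pow_ne_zero 2 hz), pow_two, tameSymbol_mul_right hp hx hz hz,
    tameSymbol_mul_self hp hx hz, mul_one]

theorem tameSymbol_mul_sq_left (hp : Irreducible p) (hx : x ≠ 0) (hy : y ≠ 0) (hz : z ≠ 0) :
    tameSymbol p (x * z ^ 2) y = tameSymbol p x y := by
  rw [tameSymbol_comm, tameSymbol_mul_sq_right hp hy hx hz, tameSymbol_comm]

/-- The Steinberg relation for the tame symbol. -/
theorem tameSymbol_steinberg (hp : Irreducible p) {s : E[X]} (hx : x ≠ 0) (hy : y ≠ 0)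
    (h : x + y = s ^ 2) : tameSymbol p x y = 1 := by
  obtain ⟨n, x, rfl, hx'⟩ := exists_eq_pow_mul_not_dvd hp hx
  obtain ⟨m, y, rfl, hy'⟩ := exists_eq_pow_mul_not_dvd hp hy
  rcases lt_trichotomy n m with hlt | rfl | hgt
  · exact tameSymbol_steinberg_of_lt hp hx' hy' hlt h
  · rw [tameSymbol_eq hp hx' hy']
    rcases Nat.even_or_odd' n with ⟨k, hk | hk⟩
    · have h1 : ∀ a : ℤ, a * a = 1 → a ^ n = 1 := by
        intro a ha; rw [hk, pow_mul, pow_two, ha, one_pow]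
      rw [pow_mul, h1 _ (quadSymbol_mul_self hx'), h1 _ (quadSymbol_mul_self hy'),
        h1 _ (quadSymbol_mul_self (not_dvd_neg_one hp))]
      simp
    · have hd : p ∣ x + y := by
        by_contra hd
        obtain ⟨k', r, hk', -⟩ := even_of_pow_mul_eq_sq hp hd (by rw [← h]; ring)
        omega
      have h1 : ∀ a : ℤ, a * a = 1 → a ^ n = a := by
        intro a ha; rw [hk, pow_succ, pow_mul, pow_two, ha, one_pow, one_mul]
      rw [pow_mul, h1 _ (quadSymbol_mul_self hx'), h1 _ (quadSymbol_mul_self hy'),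
        h1 _ (quadSymbol_mul_self (not_dvd_neg_one hp)),
        h1 _ (quadSymbol_mul_self (not_dvd_neg_one hp)), ← quadSymbol_mul hp,
        neg_one_mul, quadSymbol_congr (x := -x) (y := y) (by
          rw [show -x - y = -(x + y) by ring]; exact (dvd_neg).2 hd),
        quadSymbol_mul_self hy']
  · rw [tameSymbol_comm]
    exact tameSymbol_steinberg_of_lt hp hy' hx' hgt (by rw [← h]; ring)

/-- The tame symbol is trivial on a pair whose norm equation is solvable. -/
theorem tameSymbol_eq_one_of_sq_sub (hp : Irreducible p) {A B r s : E[X]} (hA : A ≠ 0) (hB : B ≠ 0)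
    (h : r ^ 2 - A * s ^ 2 = B) : tameSymbol p A B = 1 := by
  rcases eq_or_ne s 0 with rfl | hs
  · have h1 : B = 1 * r ^ 2 := by rw [← h]; ring
    have hr : r ≠ 0 := by rintro rfl; exact hB (by rw [h1]; ring)
    rw [h1, tameSymbol_mul_sq_right hp hA one_ne_zero hr]
    obtain ⟨n, A, rfl, hA'⟩ := exists_eq_pow_mul_not_dvd hp hA
    have h2 := tameSymbol_eq hp (n := n) (m := 0) hA' hp.not_dvd_one
    simpa [quadSymbol_one hp] using h2
  · rw [← tameSymbol_mul_sq_left hp hA hB hs]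
    exact tameSymbol_steinberg hp (mul_ne_zero hA (pow_ne_zero 2 hs)) hB (s := r)
      (by rw [← h]; ring)

end TameSymbol

section ProductFormula

variable {E : Type*} [Field E] {p r x y z : E[X]}

theorem not_dvd_of_monic_irreducible_ne (hp : Irreducible p) (hm : p.Monic) (hr : Irreducible r)
    (hrm : r.Monic) (hne : p ≠ r) : ¬ p ∣ r := fun h =>
  hne (eq_of_monic_of_associated hm hrm (hp.associated_of_dvd hr h))

theorem not_dvd_C (hp : Irreducible p) {c : E} (hc : c ≠ 0) : ¬ p ∣ C c := fun h =>
  hp.not_isUnit (isUnit_of_dvd_unit h (isUnit_C.2 hc.isUnit))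

theorem tameSymbol_self_left (hp : Irreducible p) (hy : ¬ p ∣ y) :
    tameSymbol p p y = quadSymbol p y := by
  simpa using tameSymbol_eq hp (n := 1) (m := 0) hp.not_dvd_one hy

theorem tameSymbol_self_right (hp : Irreducible p) (hy : ¬ p ∣ y) :
    tameSymbol p y p = quadSymbol p y := by
  rw [tameSymbol_comm, tameSymbol_self_left hp hy]

theorem tameSymbol_self_self (hp : Irreducible p) :
    tameSymbol p p p = quadSymbol p (-1) := by
  simpa [quadSymbol_one hp] using tameSymbol_eq hp (n := 1) (m := 1) hp.not_dvd_one hp.not_dvd_one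

/-- Induction along a factorization into a constant and monic irreducible polynomials. -/
theorem monic_irreducible_induction {P : E[X] → Prop} {S : Set E[X]}
    (hC : ∀ c : E, c ≠ 0 → P (C c))
    (hmul : ∀ r x : E[X], r ∈ S → Irreducible r → r.Monic → x ≠ 0 → P x → P (r * x)) {x : E[X]}
    (hx : x ≠ 0) (hS : ∀ r : E[X], Irreducible r → r.Monic → r ∣ x → r ∈ S) : P x := by
  induction hn : x.natDegree using Nat.strong_induction_on generalizing x with
  | _ n ih =>
    by_cases hu : IsUnit x
    · obtain ⟨c, hc, rfl⟩ := isUnit_iff.1 hu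
      exact hC c hc.ne_zero
    · obtain ⟨r, hrm, hr, y, rfl⟩ := exists_monic_irreducible_factor x hu
      have hy : y ≠ 0 := right_ne_zero_of_mul hx
      refine hmul r y (hS r hr hrm (dvd_mul_right _ _)) hr hrm hy (ih _ ?_ hy ?_ rfl)
      · rw [← hn, natDegree_mul hr.ne_zero hy]
        have := hr.natDegree_pos
        omega
      · exact fun r' h1 h2 h3 => hS r' h1 h2 (h3.mul_left _)

variable [Fintype E] [DecidableEq E]

theorem tameSymbolInfty_comm (x y : E[X]) : tameSymbolInfty x y = tameSymbolInfty y x := by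
  unfold tameSymbolInfty
  rw [mul_comm x.natDegree]; ring

theorem tameSymbolInfty_mul_right (hy : y ≠ 0) (hz : z ≠ 0) :
    tameSymbolInfty x (y * z) = tameSymbolInfty x y * tameSymbolInfty x z := by
  unfold tameSymbolInfty
  rw [natDegree_mul hy hz, leadingCoeff_mul, map_mul]
  ring

theorem quadraticChar_mul_self {c : E} (hc : c ≠ 0) :
    quadraticChar E c * quadraticChar E c = 1 := by
  rw [← pow_two, quadraticChar_sq_one hc]

/-- Hilbert reciprocity over the rational function field. -/
theorem prod_tameSymbol (hE : ringChar E ≠ 2) {S : Finset E[X]}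
    (hS : ∀ p ∈ S, Irreducible p ∧ p.Monic) (hx : x ≠ 0) (hy : y ≠ 0)
    (hxS : ∀ r : E[X], Irreducible r → r.Monic → r ∣ x → r ∈ S)
    (hyS : ∀ r : E[X], Irreducible r → r.Monic → r ∣ y → r ∈ S) :
    ∏ p ∈ S, tameSymbol p x y = tameSymbolInfty x y := by
  have hCC : ∀ c d : E, c ≠ 0 → d ≠ 0 →
      ∏ p ∈ S, tameSymbol p (C c) (C d) = tameSymbolInfty (C c) (C d) := by
    intro c d hc hd
    rw [Finset.prod_eq_one fun p hp =>
      tameSymbol_eq_one_of_not_dvd (hS p hp).1 (not_dvd_C (hS p hp).1 hc)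
        (not_dvd_C (hS p hp).1 hd)]
    simp [tameSymbolInfty]
  have hCr : ∀ (c : E) (r : E[X]), c ≠ 0 → r ∈ S →
      ∏ p ∈ S, tameSymbol p (C c) r = tameSymbolInfty (C c) r := by
    intro c r hc hrS
    obtain ⟨hr, hrm⟩ := hS r hrS
    rw [Finset.prod_eq_single r _ fun h => absurd hrS h,
      tameSymbol_self_right hr (not_dvd_C hr hc), quadSymbol_C hE hr hrm]
    · simp [tameSymbolInfty]
    · intro p hp hne
      exact tameSymbol_eq_one_of_not_dvd (hS p hp).1 (not_dvd_C (hS p hp).1 hc)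
        (not_dvd_of_monic_irreducible_ne (hS p hp).1 (hS p hp).2 hr hrm hne)
  have hrr : ∀ r s : E[X], r ∈ S → s ∈ S → ∏ p ∈ S, tameSymbol p r s = tameSymbolInfty r s := by
    intro r s hrS hsS
    obtain ⟨hr, hrm⟩ := hS r hrS
    obtain ⟨hs, hsm⟩ := hS s hsS
    rcases eq_or_ne r s with rfl | hne
    · rw [Finset.prod_eq_single r _ fun h => absurd hrS h, tameSymbol_self_self hr,
        quadSymbol_neg_one hE hr hrm]
      · simp only [tameSymbolInfty, hrm.leadingCoeff, map_one, one_pow, mul_one]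
        exact pow_eq_pow_of_mod_two (quadraticChar_mul_self (neg_ne_zero.2 one_ne_zero)) (by
          rcases Nat.mod_two_eq_zero_or_one r.natDegree with h | h <;> simp [Nat.mul_mod, h])
      · intro p hp hne
        have := not_dvd_of_monic_irreducible_ne (hS p hp).1 (hS p hp).2 hr hrm hne
        exact tameSymbol_eq_one_of_not_dvd (hS p hp).1 this this
    · rw [Finset.prod_eq_mul r s hne _ (fun h => absurd hrS h) (fun h => absurd hsS h),
        tameSymbol_self_left hr (not_dvd_of_monic_irreducible_ne hr hrm hs hsm hne),
        tameSymbol_self_right hs (not_dvd_of_monic_irreducible_ne hs hsm hr hrm hne.symm),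
        quadSymbol_reciprocity hE hr hrm hs hsm hne]
      · simp [tameSymbolInfty, hrm.leadingCoeff, hsm.leadingCoeff]
      · rintro p hp ⟨h1, h2⟩
        exact tameSymbol_eq_one_of_not_dvd (hS p hp).1
          (not_dvd_of_monic_irreducible_ne (hS p hp).1 (hS p hp).2 hr hrm h1)
          (not_dvd_of_monic_irreducible_ne (hS p hp).1 (hS p hp).2 hs hsm h2)
  have hmul : ∀ u v w : E[X], u ≠ 0 → v ≠ 0 → w ≠ 0 →
      ∏ p ∈ S, tameSymbol p u v = tameSymbolInfty u v →
      ∏ p ∈ S, tameSymbol p u w = tameSymbolInfty u w →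
      ∏ p ∈ S, tameSymbol p u (v * w) = tameSymbolInfty u (v * w) := by
    intro u v w hu hv hw h1 h2
    rw [tameSymbolInfty_mul_right hv hw, ← h1, ← h2, ← Finset.prod_mul_distrib]
    exact Finset.prod_congr rfl fun p hp => tameSymbol_mul_right (hS p hp).1 hu hv hw
  have hcomm : ∀ u v : E[X], ∏ p ∈ S, tameSymbol p u v = tameSymbolInfty u v →
      ∏ p ∈ S, tameSymbol p v u = tameSymbolInfty v u := by
    intro u v h
    rw [tameSymbolInfty_comm, ← h]
    exact Finset.prod_congr rfl fun p _ => tameSymbol_comm p v u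
  refine monic_irreducible_induction (S := (S : Set E[X]))
    (P := fun y => ∏ p ∈ S, tameSymbol p x y = tameSymbolInfty x y) ?_ ?_ hy hyS
  · intro c hc
    refine hcomm _ _ (monic_irreducible_induction (S := (S : Set E[X]))
      (P := fun x => ∏ p ∈ S, tameSymbol p (C c) x = tameSymbolInfty (C c) x) ?_ ?_ hx hxS)
    · exact fun d hd => hCC c d hc hd
    · intro r z hrS hr hrm hz h
      exact hmul _ _ _ (C_ne_zero.2 hc) hr.ne_zero hz (hCr c r hc hrS) h
  · intro s w hsS hs hsm hw h
    refine hmul _ _ _ hx hs.ne_zero hw ?_ h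
    refine hcomm _ _ (monic_irreducible_induction (S := (S : Set E[X]))
      (P := fun x => ∏ p ∈ S, tameSymbol p s x = tameSymbolInfty s x) ?_ ?_ hx hxS)
    · exact fun d hd => hcomm _ _ (hCr d s hd hsS)
    · intro r z hrS hr hrm hz h
      exact hmul _ _ _ hs.ne_zero hr.ne_zero hz (hrr s r hsS hrS) h

/-- The finite set of monic irreducible factors of a nonzero polynomial. -/
theorem exists_finset_monic_irreducible_dvd {E : Type*} [Field E] {x : E[X]} (hx : x ≠ 0) :
    ∃ S : Finset E[X], ∀ r : E[X], r ∈ S ↔ Irreducible r ∧ r.Monic ∧ r ∣ x := by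
  classical
  refine ⟨(UniqueFactorizationMonoid.normalizedFactors x).toFinset, fun r => ?_⟩
  rw [Multiset.mem_toFinset, Polynomial.mem_normalizedFactors_iff hx]

end ProductFormula

section Ternary

variable {E : Type*} [Field E]

/-- The equation `x² - A y² = B z²` has a nontrivial solution in polynomials. -/
def IsNormSolvable (A B : E[X]) : Prop :=
  ∃ x y z : E[X], (x ≠ 0 ∨ y ≠ 0 ∨ z ≠ 0) ∧ x ^ 2 - A * y ^ 2 = B * z ^ 2

theorem IsNormSolvable.symm {A B : E[X]} (h : IsNormSolvable A B) : IsNormSolvable B A := by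
  obtain ⟨x, y, z, h0, h⟩ := h
  exact ⟨x, z, y, by tauto, by linear_combination h⟩

theorem IsNormSolvable.mul_sq {A B c : E[X]} (hc : c ≠ 0) (h : IsNormSolvable A B) :
    IsNormSolvable A (B * c ^ 2) := by
  obtain ⟨x, y, z, h0, h⟩ := h
  refine ⟨c * x, c * y, z, ?_, by linear_combination c ^ 2 * h⟩
  simpa [hc] using h0

theorem isNormSolvable_of_mul {A B B' s : E[X]} (hB' : B' ≠ 0) (h : s ^ 2 - A = B * B')
    (h' : IsNormSolvable A B') : IsNormSolvable A B := by
  obtain ⟨x, y, z, h0, h'⟩ := h'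
  rcases eq_or_ne z 0 with rfl | hz
  · exact ⟨x, y, 0, h0, by linear_combination h'⟩
  · refine ⟨s * x + A * y, x + s * y, B' * z, .inr (.inr (mul_ne_zero hB' hz)), ?_⟩
    linear_combination (x ^ 2 - A * y ^ 2) * h + B * B' * h'

theorem exists_dvd_sq_sub_of_squarefree {A B : E[X]} (hB : Squarefree B)
    (h : ∀ p : E[X], Irreducible p → p.Monic → p ∣ B → ∃ s, p ∣ s ^ 2 - A) :
    ∃ s, B ∣ s ^ 2 - A := by
  refine monic_irreducible_induction (S := {p | ∃ s, p ∣ s ^ 2 - A})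
    (P := fun B => Squarefree B → ∃ s, B ∣ s ^ 2 - A) ?_ ?_ hB.ne_zero h hB
  · exact fun c hc _ => ⟨0, (isUnit_C.2 hc.isUnit).dvd⟩
  · rintro r x ⟨s, hs⟩ hr hrm hx ih hsq
    obtain ⟨t, ht⟩ := ih (hsq.squarefree_of_dvd (dvd_mul_left _ _))
    have hco : IsCoprime r x := by
      refine (hr.coprime_iff_not_dvd).2 fun hd => hr.not_isUnit (hsq r (mul_dvd_mul_left r hd))
    obtain ⟨u, v, huv⟩ := hco
    refine ⟨s * (v * x) + t * (u * r), IsCoprime.mul_dvd ⟨u, v, huv⟩ ?_ ?_⟩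
    · have h1 : s * (v * x) + t * (u * r) = s + r * (u * (t - s)) := by
        linear_combination s * huv
      rw [h1, show (s + r * (u * (t - s))) ^ 2 - A = (s ^ 2 - A) +
        r * (2 * s * (u * (t - s)) + r * (u * (t - s)) ^ 2) by ring]
      exact dvd_add hs (dvd_mul_right _ _)
    · have h1 : s * (v * x) + t * (u * r) = t + x * (v * (s - t)) := by
        linear_combination t * huv
      rw [h1, show (t + x * (v * (s - t))) ^ 2 - A = (t ^ 2 - A) +
        x * (2 * t * (v * (s - t)) + x * (v * (s - t)) ^ 2) by ring]
      exact dvd_add ht (dvd_mul_right _ _)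

theorem exists_eq_mul_sq_of_not_squarefree {B : E[X]} (hB0 : B ≠ 0) (hB : ¬ Squarefree B) :
    ∃ B' c : E[X], B = B' * c ^ 2 ∧ B' ≠ 0 ∧ c ≠ 0 ∧ B'.natDegree < B.natDegree := by
  unfold Squarefree at hB
  push Not at hB
  obtain ⟨c, ⟨B', rfl⟩, hc⟩ := hB
  have hc0 : c ≠ 0 := by rintro rfl; simp at hB0
  have hB' : B' ≠ 0 := right_ne_zero_of_mul hB0
  refine ⟨B', c, by ring, hB', hc0, ?_⟩
  rw [natDegree_mul (mul_ne_zero hc0 hc0) hB', natDegree_mul hc0 hc0]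
  have : c.natDegree ≠ 0 := fun h0 => hc (isUnit_iff_degree_eq_zero.2
    (by rw [degree_eq_natDegree hc0, h0]; rfl))
  omega

variable [Fintype E]

theorem isNormSolvable_C (hE : ringChar E ≠ 2) {a b : E} (ha : a ≠ 0) (hb : b ≠ 0) :
    IsNormSolvable (C a) (C b) := by
  obtain ⟨y, z, h⟩ := FiniteField.exists_root_sum_quadratic (f := C a * X ^ 2)
    (g := C b * X ^ 2 - C 1) (by compute_degree!) (by compute_degree!)
    (FiniteField.odd_card_of_char_ne_two hE)
  refine ⟨1, C y, C z, by simp, ?_⟩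
  simp only [eval_mul, eval_C, eval_pow, eval_X, eval_sub] at h
  have := congrArg C h
  simp only [C_mul, C_add, C_sub, C_pow, C_1, C_0] at this
  linear_combination -this

/-- The local-global principle for ternary norm equations, by descent. -/
theorem isNormSolvable_of_tameSymbol (hE : ringChar E ≠ 2) {A B : E[X]} (hA : A ≠ 0) (hB : B ≠ 0)
    (h : ∀ p : E[X], Irreducible p → p.Monic → tameSymbol p A B = 1) : IsNormSolvable A B := by
  induction hn : A.natDegree + B.natDegree using Nat.strong_induction_on generalizing A B with
  | _ n ih =>
    wlog hAB : A.natDegree ≤ B.natDegree generalizing A B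
    · exact (this hB hA (fun p hp hm => by rw [tameSymbol_comm]; exact h p hp hm) (by omega)
        (by omega)).symm
    by_cases hsq : Squarefree B
    · rcases Nat.eq_zero_or_pos B.natDegree with hd | hd
      · obtain ⟨a, rfl⟩ := natDegree_eq_zero.1 (show A.natDegree = 0 by omega)
        obtain ⟨b, rfl⟩ := natDegree_eq_zero.1 hd
        exact isNormSolvable_C hE (C_ne_zero.1 hA) (C_ne_zero.1 hB)
      obtain ⟨s, hs⟩ := exists_dvd_sq_sub_of_squarefree (A := A) hsq fun p hp hm hpB => by
        by_cases hpA : p ∣ A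
        · exact ⟨0, by simpa using hpA⟩
        obtain ⟨B', rfl⟩ := hpB
        have hpB' : ¬ p ∣ B' := fun hd => hp.not_isUnit (hsq p (mul_dvd_mul_left p hd))
        have h1 := tameSymbol_eq hp (n := 0) (m := 1) hpA hpB'
        simp only [pow_zero, pow_one, one_mul, mul_one, h p hp hm] at h1
        obtain ⟨s, hs⟩ := exists_dvd_sub_sq_of_quadSymbol h1.symm
        exact ⟨s, by rw [← neg_sub]; exact (dvd_neg).2 hs⟩
      have hs' : B ∣ (s % B) ^ 2 - A := by
        have : (s % B) ^ 2 - A = s ^ 2 - A - B * ((s / B) * (s + s % B)) := by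
          have := EuclideanDomain.div_add_mod s B
          linear_combination (s + s % B) * this
        rw [this]
        exact dvd_sub hs (dvd_mul_right _ _)
      have hlt : (s % B).natDegree < B.natDegree := natDegree_mod_lt s hd.ne'
      generalize s % B = s at hs' hlt
      obtain ⟨B', hB'⟩ := hs'
      rcases eq_or_ne B' 0 with rfl | hB0
      · exact ⟨s, 1, 0, by simp, by linear_combination hB'⟩
      refine isNormSolvable_of_mul hB0 hB' (ih _ ?_ hA hB0 ?_ rfl)
      · have h1 : (s ^ 2 - A).natDegree ≤ max (s ^ 2).natDegree A.natDegree := natDegree_sub_le _ _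
        rw [hB', natDegree_mul hB hB0, natDegree_pow] at h1
        omega
      · intro p hp hm
        have h1 := tameSymbol_eq_one_of_sq_sub hp hA (mul_ne_zero hB hB0) (r := s) (s := 1)
          (by rw [← hB']; ring)
        rwa [tameSymbol_mul_right hp hA hB hB0, h p hp hm, one_mul] at h1
    · obtain ⟨B', c, rfl, hB', hc, hlt⟩ := exists_eq_mul_sq_of_not_squarefree hB hsq
      refine (ih _ (by omega) hA hB' (fun p hp hm => ?_) rfl).mul_sq hc
      rw [← h p hp hm, tameSymbol_mul_sq_right hp hA hB' hc]

end Ternary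

section EulerProduct

variable (E : Type*) [Field E] [Fintype E]

theorem finite_monic_natDegree_eq (n : ℕ) : {g : E[X] | g.Monic ∧ g.natDegree = n}.Finite :=
  Set.finite_coe_iff.1 <| Finite.of_equiv (Fin n → E)
    ((degreeLTEquiv E n).toEquiv.symm.trans (monicEquivDegreeLT n).symm)

/-- The finite set of monic polynomials of degree `n` over a finite field. -/
noncomputable def monicsOfDegree (n : ℕ) : Finset E[X] := (finite_monic_natDegree_eq E n).toFinset

variable {E}

theorem mem_monicsOfDegree {n : ℕ} {g : E[X]} :
    g ∈ monicsOfDegree E n ↔ g.Monic ∧ g.natDegree = n := by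
  simp [monicsOfDegree]

theorem card_monicsOfDegree (n : ℕ) : (monicsOfDegree E n).card = Fintype.card E ^ n := by
  have h := Nat.card_congr ((monicEquivDegreeLT (R := E) n).trans (degreeLTEquiv E n).toEquiv)
  rwa [Nat.subtype_card (monicsOfDegree E n) fun _ => mem_monicsOfDegree, Nat.card_fun,
    Nat.card_fin,
    Nat.card_eq_fintype_card] at h

open Classical in
/-- The generating series of `χ` over the monic polynomials not divisible by an element of `F`. -/
noncomputable def sievedSeries (χ : E[X] → ℚ) (F : Finset E[X]) : PowerSeries ℚ :=
  PowerSeries.mk fun n => ∑ g ∈ monicsOfDegree E n with ∀ p ∈ F, ¬ p ∣ g, χ g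

/-- The inverse Euler factor of `χ` at `p`. -/
noncomputable def eulerFactor (χ : E[X] → ℚ) (p : E[X]) : PowerSeries ℚ :=
  1 - PowerSeries.C (χ p) * PowerSeries.X ^ p.natDegree

open Classical in
theorem sievedSeries_insert {χ : E[X] → ℚ}
    (hχ : ∀ g h : E[X], g.Monic → h.Monic → χ (g * h) = χ g * χ h) {F : Finset E[X]}
    (hF : ∀ p ∈ F, Irreducible p ∧ p.Monic) {p : E[X]} (hp : Irreducible p) (hm : p.Monic)
    (hpF : p ∉ F) :
    sievedSeries χ (insert p F) = sievedSeries χ F * eulerFactor χ p := by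
  ext n
  rw [eulerFactor, mul_sub, mul_one, map_sub, mul_left_comm, PowerSeries.coeff_C_mul,
    PowerSeries.coeff_mul_X_pow']
  simp only [sievedSeries, PowerSeries.coeff_mk]
  rw [eq_sub_iff_add_eq, ← Finset.sum_filter_add_sum_filter_not
    ((monicsOfDegree E n).filter fun g => ∀ r ∈ F, ¬ r ∣ g) (fun g => p ∣ g), add_comm]
  congr 1
  · split_ifs with hd
    · rw [Finset.mul_sum]
      refine Finset.sum_nbij (fun g => p * g) ?_ ?_ ?_ ?_
      · intro g hg
        simp only [Finset.mem_filter, mem_monicsOfDegree] at hg ⊢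
        refine ⟨⟨⟨hm.mul hg.1.1, ?_⟩, ?_⟩, dvd_mul_right _ _⟩
        · rw [hm.natDegree_mul hg.1.1, hg.1.2]; omega
        · intro r hr hrd
          rcases (hF r hr).1.prime.dvd_or_dvd hrd with h | h
          · exact not_dvd_of_monic_irreducible_ne (hF r hr).1 (hF r hr).2 hp hm
              (by rintro rfl; exact hpF hr) h
          · exact hg.2 r hr h
      · intro g _ h _ hgh
        exact mul_left_cancel₀ hp.ne_zero hgh
      · intro g hg
        simp only [Finset.coe_filter, Finset.mem_filter, mem_monicsOfDegree,
          Set.mem_ofPred_eq] at hg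
        obtain ⟨⟨⟨h1, h2⟩, h3⟩, k, rfl⟩ := hg
        have hk := hm.of_mul_monic_left h1
        refine ⟨k, ?_, rfl⟩
        simp only [Finset.coe_filter, mem_monicsOfDegree, Set.mem_ofPred_eq]
        refine ⟨⟨hk, ?_⟩, fun r hr h => h3 r hr (h.mul_left _)⟩
        rw [hm.natDegree_mul hk] at h2; omega
      · intro g hg
        simp only [Finset.mem_filter, mem_monicsOfDegree] at hg
        exact (hχ p g hm hg.1.1).symm
    · rw [Finset.sum_eq_zero, mul_zero]
      intro g hg
      simp only [Finset.mem_filter, mem_monicsOfDegree] at hg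
      exact absurd (natDegree_le_of_dvd hg.2 hg.1.1.1.ne_zero) (by omega)
  · rw [Finset.filter_filter]
    refine Finset.sum_congr ?_ fun _ _ => rfl
    ext g
    simp only [Finset.mem_filter, Finset.mem_insert, forall_eq_or_imp]
    tauto

theorem sievedSeries_union {χ : E[X] → ℚ}
    (hχ : ∀ g h : E[X], g.Monic → h.Monic → χ (g * h) = χ g * χ h) {F : Finset E[X]}
    (hF : ∀ p ∈ F, Irreducible p ∧ p.Monic) :
    sievedSeries χ F = sievedSeries χ ∅ * ∏ p ∈ F, eulerFactor χ p := by
  classical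
  induction F using Finset.induction_on with
  | empty => simp
  | insert p F hp ih =>
    rw [sievedSeries_insert hχ (fun r hr => hF r (Finset.mem_insert_of_mem hr))
      (hF p (Finset.mem_insert_self _ _)).1 (hF p (Finset.mem_insert_self _ _)).2 hp,
      ih (fun r hr => hF r (Finset.mem_insert_of_mem hr)), Finset.prod_insert hp]
    ring

variable (E) in
/-- The finite set of monic irreducible polynomials of degree at most `N`. -/
theorem exists_finset_monic_irreducible_natDegree_le (N : ℕ) :
    ∃ F : Finset E[X], ∀ p, p ∈ F ↔ Irreducible p ∧ p.Monic ∧ p.natDegree ≤ N := by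
  classical
  refine ⟨((Finset.range (N + 1)).biUnion (monicsOfDegree E)).filter Irreducible, fun p => ?_⟩
  simp only [Finset.mem_filter, Finset.mem_biUnion, Finset.mem_range, mem_monicsOfDegree]
  constructor
  · rintro ⟨⟨n, h1, h2, rfl⟩, h3⟩; exact ⟨h3, h2, by omega⟩
  · rintro ⟨h1, h2, h3⟩; exact ⟨⟨_, by omega, h2, rfl⟩, h1⟩

/-- Sieving out all primes of degree at most `N` leaves only the constant term up to degree `N`. -/
theorem X_pow_dvd_mul_prod_eulerFactor_sub_one {χ : E[X] → ℚ} (hχ1 : χ 1 = 1)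
    (hχ : ∀ g h : E[X], g.Monic → h.Monic → χ (g * h) = χ g * χ h) {F : Finset E[X]} {N : ℕ}
    (hF : ∀ p, p ∈ F ↔ Irreducible p ∧ p.Monic ∧ p.natDegree ≤ N) :
    PowerSeries.X ^ (N + 1) ∣ sievedSeries χ ∅ * ∏ p ∈ F, eulerFactor χ p - 1 := by
  classical
  rw [← sievedSeries_union hχ fun p hp => ⟨((hF p).1 hp).1, ((hF p).1 hp).2.1⟩,
    PowerSeries.X_pow_dvd_iff]
  intro n hn
  rw [map_sub, sub_eq_zero, sievedSeries, PowerSeries.coeff_mk, PowerSeries.coeff_one]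
  split_ifs with h0
  · subst h0
    rw [Finset.sum_eq_single 1, hχ1]
    · intro g hg hne
      simp only [Finset.mem_filter, mem_monicsOfDegree] at hg
      exact absurd ((hg.1.1.natDegree_eq_zero).1 hg.1.2) hne
    · intro h
      refine absurd ?_ h
      simp only [Finset.mem_filter, mem_monicsOfDegree]
      exact ⟨⟨monic_one, natDegree_one⟩, fun p hp => ((hF p).1 hp).1.not_dvd_one⟩
  · refine Finset.sum_eq_zero fun g hg => ?_
    simp only [Finset.mem_filter, mem_monicsOfDegree] at hg
    obtain ⟨⟨hgm, hgd⟩, hg⟩ := hg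
    have hu : ¬ IsUnit g := fun hu => h0 (by rw [← hgd, natDegree_eq_zero_of_isUnit hu])
    obtain ⟨r, hrm, hr, hrg⟩ := exists_monic_irreducible_factor g hu
    refine absurd hrg (hg r ((hF r).2 ⟨hr, hrm, ?_⟩))
    have := natDegree_le_of_dvd hrg hgm.ne_zero
    omega

end EulerProduct

section LSeries

variable {E : Type*} [Field E]

theorem coeff_mul_one_sub_X_pow (f : PowerSeries ℚ) (e n : ℕ) :
    PowerSeries.coeff n (f * (1 - PowerSeries.X ^ e)) =
      PowerSeries.coeff n f - if e ≤ n then PowerSeries.coeff (n - e) f else 0 := by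
  rw [mul_sub, mul_one, map_sub, PowerSeries.coeff_mul_X_pow']

theorem coeff_nonneg_of_mul_one_sub_X_pow {f : PowerSeries ℚ} {e N : ℕ} (he : 0 < e)
    (h : ∀ n ≤ N, 0 ≤ PowerSeries.coeff n (f * (1 - PowerSeries.X ^ e))) :
    ∀ n ≤ N, 0 ≤ PowerSeries.coeff n f := by
  intro n
  induction n using Nat.strong_induction_on with
  | _ n ih =>
    intro hn
    have h1 := h n hn
    rw [coeff_mul_one_sub_X_pow] at h1
    split_ifs at h1 with h2
    · have := ih (n - e) (by omega) (by omega)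
      linarith
    · linarith

theorem eulerFactor_mul_eulerFactor {χ₁ χ₂ : E[X] → ℚ} {p : E[X]} (h1 : χ₁ p = 1)
    (h2 : χ₂ p = 1 ∨ χ₂ p = -1) :
    eulerFactor χ₁ p * eulerFactor χ₂ p =
        (1 - PowerSeries.X ^ p.natDegree) * (1 - PowerSeries.X ^ p.natDegree) ∨
      eulerFactor χ₁ p * eulerFactor χ₂ p = 1 - PowerSeries.X ^ (2 * p.natDegree) := by
  rcases h2 with h2 | h2
  · left; simp [eulerFactor, h1, h2]
  · right; simp only [eulerFactor, h1, h2, map_one, map_neg]; ring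

theorem coeff_nonneg_of_mul_prod_eulerFactor {χ₁ χ₂ : E[X] → ℚ} {F : Finset E[X]}
    (hF : ∀ p ∈ F, Irreducible p)
    (h : ∀ p ∈ F, (χ₁ p = 0 ∧ χ₂ p = 0) ∨ (χ₁ p = 1 ∧ (χ₂ p = 1 ∨ χ₂ p = -1)))
    {f : PowerSeries ℚ} {N : ℕ}
    (hf : ∀ n ≤ N, 0 ≤ PowerSeries.coeff n (f * ∏ p ∈ F, (eulerFactor χ₁ p * eulerFactor χ₂ p))) :
    ∀ n ≤ N, 0 ≤ PowerSeries.coeff n f := by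
  classical
  induction F using Finset.induction_on with
  | empty => simpa using hf
  | insert p F hp ih =>
    refine ih (fun r hr => hF r (Finset.mem_insert_of_mem hr))
      (fun r hr => h r (Finset.mem_insert_of_mem hr)) ?_
    rw [Finset.prod_insert hp, mul_comm (_ * _), ← mul_assoc] at hf
    have hd := (hF p (Finset.mem_insert_self _ _)).natDegree_pos
    rcases h p (Finset.mem_insert_self _ _) with ⟨h1, h2⟩ | ⟨h1, h2⟩
    · simpa [eulerFactor, h1, h2] using hf
    · rcases eulerFactor_mul_eulerFactor h1 h2 with h3 | h3
      · rw [h3, ← mul_assoc] at hf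
        exact coeff_nonneg_of_mul_one_sub_X_pow hd (coeff_nonneg_of_mul_one_sub_X_pow hd hf)
      · rw [h3] at hf
        exact coeff_nonneg_of_mul_one_sub_X_pow (by omega) hf

variable [Fintype E]

/-- Finite products of Euler products agree if they do so factor by factor. -/
theorem prod_sievedSeries_eq {ι : Type*} {χ : ι → E[X] → ℚ} (hχ1 : ∀ i, χ i 1 = 1)
    (hχ : ∀ i, ∀ g h : E[X], g.Monic → h.Monic → χ i (g * h) = χ i g * χ i h) {s t : Finset ι}
    (h : ∀ p : E[X], Irreducible p → p.Monic →
      ∏ i ∈ s, eulerFactor (χ i) p = ∏ i ∈ t, eulerFactor (χ i) p) :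
    ∏ i ∈ s, sievedSeries (χ i) ∅ = ∏ i ∈ t, sievedSeries (χ i) ∅ := by
  rw [← sub_eq_zero]
  ext n
  rw [map_zero]
  refine (PowerSeries.X_pow_dvd_iff (n := n + 1)).1 ?_ n (Nat.lt_succ_self n)
  obtain ⟨F, hF⟩ := exists_finset_monic_irreducible_natDegree_le E n
  let φ := Ideal.Quotient.mk (Ideal.span {(PowerSeries.X : PowerSeries ℚ) ^ (n + 1)})
  have hφ : ∀ u : Finset ι,
      φ (∏ i ∈ u, sievedSeries (χ i) ∅) * φ (∏ p ∈ F, ∏ i ∈ u, eulerFactor (χ i) p) = 1 := by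
    intro u
    rw [← map_mul, Finset.prod_comm, ← Finset.prod_mul_distrib, map_prod]
    refine Finset.prod_eq_one fun i _ => ?_
    rw [← map_one φ, Ideal.Quotient.mk_eq_mk_iff_sub_mem, Ideal.mem_span_singleton]
    exact X_pow_dvd_mul_prod_eulerFactor_sub_one (hχ1 i) (hχ i) hF
  have hs := hφ s
  have ht := hφ t
  rw [Finset.prod_congr rfl fun p hp => h p ((hF p).1 hp).1 ((hF p).1 hp).2.1, mul_comm] at hs
  rw [← Ideal.mem_span_singleton, ← Ideal.Quotient.mk_eq_mk_iff_sub_mem]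
  exact (left_inv_eq_right_inv ht hs).symm

/-- A product of two Euler products, the second being a twist of the first by signs, has infinitely
many coefficients that are at least one. -/
theorem exists_one_le_coeff_sievedSeries_mul {χ₁ χ₂ : E[X] → ℚ} (h11 : χ₁ 1 = 1) (h21 : χ₂ 1 = 1)
    (hχ₁ : ∀ g h : E[X], g.Monic → h.Monic → χ₁ (g * h) = χ₁ g * χ₁ h)
    (hχ₂ : ∀ g h : E[X], g.Monic → h.Monic → χ₂ (g * h) = χ₂ g * χ₂ h)
    (h : ∀ p : E[X], Irreducible p → p.Monic →
      (χ₁ p = 0 ∧ χ₂ p = 0) ∨ (χ₁ p = 1 ∧ (χ₂ p = 1 ∨ χ₂ p = -1)))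
    {p : E[X]} (hp : Irreducible p) (hm : p.Monic) (hp0 : χ₁ p ≠ 0) :
    ∃ e : ℕ, 0 < e ∧
      ∀ k : ℕ, 1 ≤ PowerSeries.coeff (e * k) (sievedSeries χ₁ ∅ * sievedSeries χ₂ ∅) := by
  classical
  set f := sievedSeries χ₁ ∅ * sievedSeries χ₂ ∅ with hf
  have hone : ∀ (N : ℕ) (F : Finset E[X]),
      (∀ p, p ∈ F ↔ Irreducible p ∧ p.Monic ∧ p.natDegree ≤ N) → ∀ n ≤ N,
      PowerSeries.coeff n (f * ∏ p ∈ F, (eulerFactor χ₁ p * eulerFactor χ₂ p)) =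
        PowerSeries.coeff n 1 := by
    intro N F hF n hn
    obtain ⟨a, ha⟩ := X_pow_dvd_mul_prod_eulerFactor_sub_one h11 hχ₁ hF
    obtain ⟨b, hb⟩ := X_pow_dvd_mul_prod_eulerFactor_sub_one h21 hχ₂ hF
    rw [← sub_eq_zero, ← map_sub]
    refine (PowerSeries.X_pow_dvd_iff (n := N + 1)).1
      ⟨a * (sievedSeries χ₂ ∅ * ∏ p ∈ F, eulerFactor χ₂ p) + b, ?_⟩ n (by omega)
    rw [Finset.prod_mul_distrib, hf]
    linear_combination (sievedSeries χ₂ ∅ * ∏ p ∈ F, eulerFactor χ₂ p) * ha + hb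
  have hf0 : PowerSeries.coeff 0 f = 1 := by
    have := hone 0 ∅ (fun p => by
      simp only [Finset.notMem_empty, false_iff]
      rintro ⟨h1, -, h2⟩
      have := h1.natDegree_pos
      omega) 0 le_rfl
    simpa using this
  have hg : ∀ n, 0 ≤ PowerSeries.coeff n (f * (eulerFactor χ₁ p * eulerFactor χ₂ p)) := by
    intro n
    obtain ⟨F, hF⟩ := exists_finset_monic_irreducible_natDegree_le E (n + p.natDegree)
    refine coeff_nonneg_of_mul_prod_eulerFactor (χ₁ := χ₁) (χ₂ := χ₂) (F := F.erase p)
      (N := n + p.natDegree)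
      (fun r hr => ((hF r).1 (Finset.mem_of_mem_erase hr)).1)
      (fun r hr => h r ((hF r).1 (Finset.mem_of_mem_erase hr)).1
        ((hF r).1 (Finset.mem_of_mem_erase hr)).2.1) ?_ n (by omega)
    intro k hk
    rw [mul_assoc, Finset.mul_prod_erase F (fun p => eulerFactor χ₁ p * eulerFactor χ₂ p)
      ((hF p).2 ⟨hp, hm, by omega⟩), hone _ F hF k hk, PowerSeries.coeff_one]
    split_ifs <;> simp
  obtain ⟨e, he, hge⟩ : ∃ e : ℕ, 0 < e ∧
      ∀ n, 0 ≤ PowerSeries.coeff n (f * (1 - PowerSeries.X ^ e)) := by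
    have hd := hp.natDegree_pos
    rcases h p hp hm with h1 | ⟨h1, h2⟩
    · exact absurd h1.1 hp0
    rcases eulerFactor_mul_eulerFactor h1 h2 with h3 | h3
    · rw [h3, ← mul_assoc] at hg
      exact ⟨_, hd, fun n => coeff_nonneg_of_mul_one_sub_X_pow hd (fun k _ => hg k) n le_rfl⟩
    · rw [h3] at hg
      exact ⟨_, by omega, hg⟩
  refine ⟨e, he, fun k => ?_⟩
  induction k with
  | zero => rw [mul_zero, hf0]
  | succ k ih =>
    have h1 := hge (e * (k + 1))
    rw [coeff_mul_one_sub_X_pow, if_pos (Nat.le_mul_of_pos_right e k.succ_pos),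
      show e * (k + 1) - e = e * k by rw [mul_add, mul_one, Nat.add_sub_cancel]] at h1
    linarith

end LSeries

section Twist

variable {E : Type*} [Field E]

/-- The class of `g` recording the parity of its degree and its quadratic symbols at `S`. -/
noncomputable def signClass (S : Finset E[X]) (g : E[X]) : Option S → ℤˣ
  | none => (-1) ^ g.natDegree
  | some p => if quadSymbol p g = 1 then 1 else -1

open Classical in
/-- The character `ψ` of sign classes, extended by zero to the polynomials not prime to `S`. -/
noncomputable def signTwist (S : Finset E[X]) (ψ : (Option S → ℤˣ) →* ℤˣ) (g : E[X]) : ℚ :=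
  if ∀ p ∈ S, ¬ p ∣ g then ((ψ (signClass S g) : ℤ) : ℚ) else 0

variable {S : Finset E[X]} {g h : E[X]}

theorem signClass_one (hS : ∀ p ∈ S, Irreducible p ∧ p.Monic) : signClass S 1 = 1 := by
  ext i
  rcases i with _ | p
  · simp [signClass]
  · simp [signClass, quadSymbol_one (hS p p.2).1]

theorem signTwist_one (hS : ∀ p ∈ S, Irreducible p ∧ p.Monic) (ψ : (Option S → ℤˣ) →* ℤˣ) :
    signTwist S ψ 1 = 1 := by
  rw [signTwist, if_pos fun p hp => (hS p hp).1.not_dvd_one, signClass_one hS]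
  simp

theorem signTwist_of_dvd {ψ : (Option S → ℤˣ) →* ℤˣ} {p : E[X]} (hp : p ∈ S) (h : p ∣ g) :
    signTwist S ψ g = 0 := by
  rw [signTwist, if_neg]
  exact fun h' => h' p hp h

theorem signTwist_of_not_dvd {ψ : (Option S → ℤˣ) →* ℤˣ} (h : ∀ p ∈ S, ¬ p ∣ g) :
    signTwist S ψ g = (ψ (signClass S g) : ℤ) := if_pos h

theorem finset_not_dvd_of_irreducible (hS : ∀ p ∈ S, Irreducible p ∧ p.Monic) (hg : Irreducible g)
    (hm : g.Monic) (hgS : g ∉ S) : ∀ p ∈ S, ¬ p ∣ g := fun p hp =>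
  not_dvd_of_monic_irreducible_ne (hS p hp).1 (hS p hp).2 hg hm fun h => hgS (h ▸ hp)

theorem mk_pow_mul_one_sub (a : ℚ) :
    (1 - PowerSeries.C a * PowerSeries.X) * PowerSeries.mk (fun n => a ^ n) = 1 := by
  ext n
  rw [sub_mul, one_mul, map_sub, mul_assoc, PowerSeries.coeff_C_mul]
  cases n with
  | zero => simp
  | succ n =>
    rw [PowerSeries.coeff_succ_X_mul, PowerSeries.coeff_mk, PowerSeries.coeff_mk,
      PowerSeries.coeff_one, if_neg n.succ_ne_zero, pow_succ]
    ring

/-- A character of sign classes trivial on the components at `S` depends only on the degree. -/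
theorem map_signClass_of_forall_eq_one {ψ : (Option S → ℤˣ) →* ℤˣ} [DecidableEq (Option S)]
    (hψ : ∀ p : S, ψ (Pi.mulSingle (some p) (-1)) = 1) (g : E[X]) :
    ψ (signClass S g) = ψ (Pi.mulSingle none (-1)) ^ g.natDegree := by
  have h : ∀ (p : S) (u : ℤˣ), ψ (Pi.mulSingle (some p) u) = 1 := by
    intro p u
    rcases Int.units_eq_one_or u with rfl | rfl
    · simp
    · exact hψ p
  rw [← Finset.univ_prod_mulSingle (signClass S g), map_prod, Fintype.prod_option,
    Finset.prod_eq_one fun p _ => h p _, mul_one, ← map_pow, ← Pi.mulSingle_pow]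
  rfl

variable [Fintype E]

theorem signClass_mul (hS : ∀ p ∈ S, Irreducible p ∧ p.Monic) (hg : g ≠ 0) (hh : h ≠ 0)
    (hgS : ∀ p ∈ S, ¬ p ∣ g) (hhS : ∀ p ∈ S, ¬ p ∣ h) :
    signClass S (g * h) = signClass S g * signClass S h := by
  funext i
  rcases i with _ | p
  · simp [signClass, natDegree_mul hg hh, pow_add]
  · simp only [signClass, Pi.mul_apply, quadSymbol_mul (hS p p.2).1]
    rcases quadSymbol_eq_one_or_neg_one (hgS p p.2) with h1 | h1 <;>
      rcases quadSymbol_eq_one_or_neg_one (hhS p p.2) with h2 | h2 <;> simp [h1, h2]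

theorem signTwist_mul (hS : ∀ p ∈ S, Irreducible p ∧ p.Monic) (ψ : (Option S → ℤˣ) →* ℤˣ)
    (hg : g.Monic) (hh : h.Monic) : signTwist S ψ (g * h) = signTwist S ψ g * signTwist S ψ h := by
  by_cases h1 : ∀ p ∈ S, ¬ p ∣ g
  · by_cases h2 : ∀ p ∈ S, ¬ p ∣ h
    · rw [signTwist_of_not_dvd h1, signTwist_of_not_dvd h2, signTwist_of_not_dvd,
        signClass_mul hS hg.ne_zero hh.ne_zero h1 h2]
      · simp
      · exact fun p hp hd => ((hS p hp).1.prime.dvd_or_dvd hd).elim (h1 p hp) (h2 p hp)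
    · push Not at h2
      obtain ⟨p, hp, hd⟩ := h2
      rw [signTwist_of_dvd hp hd, signTwist_of_dvd hp (hd.mul_left _), mul_zero]
  · push Not at h1
    obtain ⟨p, hp, hd⟩ := h1
    rw [signTwist_of_dvd hp hd, signTwist_of_dvd hp (hd.mul_right _), zero_mul]

theorem one_sub_mul_sievedSeries_signTwist (hS : ∀ p ∈ S, Irreducible p ∧ p.Monic)
    {ψ : (Option S → ℤˣ) →* ℤˣ} {ε : ℚ}
    (hψ : ∀ g : E[X], ((ψ (signClass S g) : ℤ) : ℚ) = ε ^ g.natDegree) :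
    (1 - PowerSeries.C (ε * Fintype.card E) * PowerSeries.X) * sievedSeries (signTwist S ψ) ∅ =
      ∏ p ∈ S, (1 - PowerSeries.C (ε ^ p.natDegree) * PowerSeries.X ^ p.natDegree) := by
  classical
  have h1 : sievedSeries (signTwist S ψ) ∅ = sievedSeries (fun g : E[X] => ε ^ g.natDegree) S := by
    ext n
    simp only [sievedSeries, PowerSeries.coeff_mk, Finset.notMem_empty, false_imp_iff,
      implies_true, Finset.filter_true]
    rw [Finset.sum_filter]
    refine Finset.sum_congr rfl fun g _ => ?_
    rw [signTwist, hψ]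
  have h2 : sievedSeries (fun g : E[X] => ε ^ g.natDegree) ∅ =
      PowerSeries.mk fun n => (ε * Fintype.card E) ^ n := by
    ext n
    simp only [sievedSeries, PowerSeries.coeff_mk, Finset.notMem_empty, false_imp_iff,
      implies_true, Finset.filter_true]
    rw [Finset.sum_congr rfl fun g hg => by rw [(mem_monicsOfDegree.1 hg).2], Finset.sum_const,
      card_monicsOfDegree, nsmul_eq_mul, mul_pow]
    push_cast
    ring
  rw [h1, sievedSeries_union (fun g h hg hh => by rw [hg.natDegree_mul hh, pow_add]) hS, h2,
    ← mul_assoc, mk_pow_mul_one_sub, one_mul]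
  rfl

open Classical in
/-- The Chinese remainder theorem for one prescribed and otherwise trivial residues. -/
theorem exists_quadSymbol_eq_neg_one_and_dvd_sub_one (hE : ringChar E ≠ 2)
    (hS : ∀ p ∈ S, Irreducible p ∧ p.Monic) {p : E[X]} (hp : p ∈ S) :
    ∃ k : E[X], quadSymbol p k = -1 ∧ ∀ r ∈ S, r ≠ p → r ∣ k - 1 := by
  obtain ⟨w, hw⟩ := exists_quadSymbol_eq_neg_one hE (hS p hp).1
  have hco : IsCoprime p (∏ r ∈ S.erase p, r) := by
    refine IsCoprime.prod_right fun r hr => ?_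
    have hr' := Finset.mem_of_mem_erase hr
    exact ((hS p hp).1.coprime_iff_not_dvd).2 (not_dvd_of_monic_irreducible_ne (hS p hp).1
      (hS p hp).2 (hS r hr').1 (hS r hr').2 (Finset.ne_of_mem_erase hr).symm)
  obtain ⟨u, v, huv⟩ := hco
  refine ⟨w * (v * ∏ r ∈ S.erase p, r) + u * p, ?_, fun r hr hne => ?_⟩
  · rw [← hw]
    refine quadSymbol_congr ⟨u * (1 - w), ?_⟩
    linear_combination w * huv
  · have : r ∣ ∏ r ∈ S.erase p, r := Finset.dvd_prod_of_mem _ (Finset.mem_erase.2 ⟨hne, hr⟩)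
    refine this.trans ⟨v * (w - 1), ?_⟩
    linear_combination huv

theorem coeff_sievedSeries_signTwist_eq_zero (hE : ringChar E ≠ 2)
    (hS : ∀ p ∈ S, Irreducible p ∧ p.Monic) {ψ : (Option S → ℤˣ) →* ℤˣ} [DecidableEq (Option S)]
    {p : S} (hψ : ψ (Pi.mulSingle (some p) (-1)) = -1) {n : ℕ}
    (hn : (∏ p ∈ S, p).natDegree ≤ n) :
    PowerSeries.coeff n (sievedSeries (signTwist S ψ) ∅) = 0 := by
  classical
  set m := ∏ p ∈ S, p with hm
  have hmm : m.Monic := monic_prod_of_monic _ _ fun p hp => (hS p hp).2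
  obtain ⟨k, hk1, hk2⟩ := exists_quadSymbol_eq_neg_one_and_dvd_sub_one hE hS p.2
  have hkS : ∀ r ∈ S, ¬ r ∣ k := by
    intro r hr hd
    by_cases hrp : r = p
    · subst hrp
      rw [quadSymbol_eq_zero_iff.2 hd] at hk1
      norm_num at hk1
    · exact (hS r hr).1.not_dvd_one (by simpa using dvd_sub hd (hk2 r hr hrp))
  let σ : E[X] → E[X] := fun g => g - g %ₘ m + (k * g) %ₘ m
  have hσ : ∀ g, m ∣ σ g - k * g := by
    intro g
    have h1 := modByMonic_add_div g m
    have h2 := modByMonic_add_div (k * g) m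
    refine ⟨g /ₘ m - (k * g) /ₘ m, ?_⟩
    simp only [σ]
    linear_combination -h1 + h2
  have hσS : ∀ g, ∀ r ∈ S, r ∣ σ g - k * g := fun g r hr =>
    (Finset.dvd_prod_of_mem _ hr).trans (hσ g)
  have hσm : ∀ g ∈ monicsOfDegree E n, σ g ∈ monicsOfDegree E n := by
    intro g hg
    rw [mem_monicsOfDegree] at hg ⊢
    have hlt : ∀ w : E[X], (w %ₘ m).degree < g.degree := fun w =>
      (degree_modByMonic_lt w hmm).trans_le (by
        rw [degree_eq_natDegree hmm.ne_zero, degree_eq_natDegree hg.1.ne_zero, hg.2]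
        exact_mod_cast hn)
    have hd : (-(g %ₘ m) + (k * g) %ₘ m).degree < g.degree :=
      (degree_add_le _ _).trans_lt (max_lt (by rw [degree_neg]; exact hlt g) (hlt _))
    have he : σ g = g + (-(g %ₘ m) + (k * g) %ₘ m) := by simp only [σ]; ring
    rw [he]
    exact ⟨hg.1.add_of_left hd, by rw [natDegree_add_eq_left_of_degree_lt hd, hg.2]⟩
  have hinj : Set.InjOn σ (monicsOfDegree E n : Set E[X]) := by
    intro g _ g' _ h
    have hmk : IsCoprime m k := IsCoprime.prod_left fun r hr =>
      ((hS r hr).1.coprime_iff_not_dvd).2 (hkS r hr)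
    have h1 : m ∣ g - g' := by
      refine hmk.dvd_of_dvd_mul_left (y := k) ?_
      have := dvd_sub (hσ g') (hσ g)
      rw [h] at this
      convert this using 1
      ring
    have h2 : g %ₘ m = g' %ₘ m := by
      rw [← sub_eq_zero, ← sub_modByMonic]
      exact (modByMonic_eq_zero_iff_dvd hmm).2 h1
    have h3 : (k * g) %ₘ m = (k * g') %ₘ m := by
      rw [← sub_eq_zero, ← sub_modByMonic, ← mul_sub]
      exact (modByMonic_eq_zero_iff_dvd hmm).2 (h1.mul_left _)
    simpa [σ, h2, h3] using h
  have hneg : ∀ g ∈ monicsOfDegree E n, signTwist S ψ g = -signTwist S ψ (σ g) := by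
    intro g hg
    have hdvd : ∀ r ∈ S, (r ∣ σ g ↔ r ∣ g) := by
      intro r hr
      rw [← quadSymbol_eq_zero_iff, quadSymbol_congr (hσS g r hr), quadSymbol_eq_zero_iff]
      exact ⟨fun h => ((hS r hr).1.prime.dvd_or_dvd h).resolve_left (hkS r hr),
        fun h => h.mul_left _⟩
    by_cases hgS : ∀ r ∈ S, ¬ r ∣ g
    · rw [signTwist_of_not_dvd hgS,
        signTwist_of_not_dvd fun r hr => by rw [hdvd r hr]; exact hgS r hr]
      have hcls : signClass S (σ g) = Pi.mulSingle (some p) (-1) * signClass S g := by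
        funext i
        rcases i with _ | r
        · simp [signClass, (mem_monicsOfDegree.1 hg).2, (mem_monicsOfDegree.1 (hσm g hg)).2]
        · simp only [signClass, Pi.mul_apply]
          rw [quadSymbol_congr (hσS g r r.2), quadSymbol_mul (hS r r.2).1]
          by_cases hrp : r = p
          · subst hrp
            rw [hk1, Pi.mulSingle_eq_same]
            rcases quadSymbol_eq_one_or_neg_one (hgS r r.2) with h1 | h1 <;> simp [h1]
          · rw [Pi.mulSingle_eq_of_ne (fun h => hrp (Option.some_injective _ h)), quadSymbol_congr
              (hk2 r r.2 fun h => hrp (Subtype.ext h)), quadSymbol_one (hS r r.2).1]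
            simp
      rw [hcls, map_mul, hψ]
      simp
    · push Not at hgS
      obtain ⟨r, hr, hd⟩ := hgS
      rw [signTwist_of_dvd hr hd, signTwist_of_dvd hr ((hdvd r hr).2 hd), neg_zero]
  simp only [sievedSeries, PowerSeries.coeff_mk, Finset.notMem_empty, false_imp_iff,
    implies_true, Finset.filter_true]
  have hsum := Finset.sum_nbij (f := fun g => -signTwist S ψ (σ g)) (g := fun g => -signTwist S ψ g)
    σ hσm hinj (Finset.surjOn_of_injOn_of_card_le σ hσm hinj le_rfl) fun _ _ => rfl
  have := (Finset.sum_congr rfl hneg).trans hsum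
  rw [Finset.sum_neg_distrib] at this
  linarith

end Twist

section Dirichlet

theorem exists_character_separating {ι : Type*} {h k : ι → ℤˣ} (hh : h ≠ 1) (hk : k ≠ h) :
    ∃ ψ : (ι → ℤˣ) →* ℤˣ, ψ h = -1 ∧ ψ k = 1 := by
  obtain ⟨i, hi⟩ := Function.ne_iff.1 hh
  obtain ⟨j, hj⟩ := Function.ne_iff.1 hk
  let ev : ι → (ι → ℤˣ) →* ℤˣ := fun i => Pi.evalMonoidHom _ i
  have hi' : h i = -1 := (Int.units_eq_one_or _).resolve_left hi
  rcases Int.units_eq_one_or (k i) with h1 | h1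
  · exact ⟨ev i, hi', h1⟩
  · rcases Int.units_eq_one_or (h j) with h2 | h2
    · have h3 : k j = -1 := (Int.units_eq_one_or _).resolve_left (h2 ▸ hj)
      exact ⟨ev i * ev j, by simp [ev, hi', h2], by simp [ev, h1, h3]⟩
    · have h3 : k j = 1 := (Int.units_eq_one_or _).resolve_right (h2 ▸ hj)
      exact ⟨ev j, h2, h3⟩

variable {E : Type*} [Field E] {S : Finset E[X]}

theorem exists_monic_irreducible_notMem (hS : ∀ p ∈ S, Irreducible p ∧ p.Monic) :
    ∃ p : E[X], Irreducible p ∧ p.Monic ∧ p ∉ S := by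
  have hm : (∏ p ∈ S, p).Monic := monic_prod_of_monic _ _ fun p hp => (hS p hp).2
  obtain ⟨p, hpm, hp, hd⟩ := exists_monic_irreducible_factor ((∏ p ∈ S, p) * X + C 1) fun hu => by
    have := natDegree_eq_zero_of_isUnit hu
    rw [natDegree_add_C, natDegree_mul_X hm.ne_zero] at this
    omega
  refine ⟨p, hp, hpm, fun hpS => hp.not_dvd_one ?_⟩
  rw [C_1] at hd
  exact (dvd_add_right ((Finset.dvd_prod_of_mem (fun p => p) hpS).mul_right X)).1 hd

variable [Fintype E]

theorem one_sub_C_mul_X_mul_sievedSeries_one (hS : ∀ p ∈ S, Irreducible p ∧ p.Monic) :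
    ((1 - C (Fintype.card E : ℚ) * X : ℚ[X]) : PowerSeries ℚ) * sievedSeries (signTwist S 1) ∅ =
      ((∏ p ∈ S, (1 - X ^ p.natDegree) : ℚ[X]) : PowerSeries ℚ) := by
  have := one_sub_mul_sievedSeries_signTwist hS (ψ := 1) (ε := 1) (by simp)
  rw [← Polynomial.coeToPowerSeries.ringHom_apply, ← Polynomial.coeToPowerSeries.ringHom_apply,
    map_prod]
  simp only [map_sub, map_one, map_mul, map_pow, coeToPowerSeries.ringHom_apply, coe_C, coe_X]
  simpa only [one_mul, one_pow, map_one] using this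

/-- Nonvanishing of the `L`-polynomial of a nontrivial quadratic character at `1 / q`. -/
theorem eval_ne_zero_of_coe_eq_sievedSeries (hS : ∀ p ∈ S, Irreducible p ∧ p.Monic)
    {ψ : (Option S → ℤˣ) →* ℤˣ} {M : ℚ[X]}
    (hM : (M : PowerSeries ℚ) = sievedSeries (signTwist S ψ) ∅) :
    M.eval (1 / (Fintype.card E : ℚ)) ≠ 0 := by
  intro h0
  have hq : (Fintype.card E : ℚ) ≠ 0 := by simp
  obtain ⟨R, rfl⟩ := dvd_iff_isRoot.2 h0
  have h1 : (X - C (1 / (Fintype.card E : ℚ))) * R =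
      (1 - C (Fintype.card E : ℚ) * X) * (C (-1 / (Fintype.card E : ℚ)) * R) := by
    have h2 : C (Fintype.card E : ℚ) * C (-1 / (Fintype.card E : ℚ)) = -1 := by
      rw [← C_mul, mul_div_cancel₀ _ hq]; simp
    have h3 : C (1 / (Fintype.card E : ℚ)) = -C (-1 / (Fintype.card E : ℚ)) := by
      rw [← C_neg]; congr 1; ring
    rw [h3]
    linear_combination (X * R) * h2
  obtain ⟨p, hp, hm, hpS⟩ := exists_monic_irreducible_notMem hS
  obtain ⟨e, he, hcoeff⟩ := exists_one_le_coeff_sievedSeries_mul (signTwist_one hS 1)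
    (signTwist_one hS ψ) (fun g h hg hh => signTwist_mul hS 1 hg hh)
    (fun g h hg hh => signTwist_mul hS ψ hg hh) (fun r hr hrm => by
      by_cases hrS : r ∈ S
      · exact .inl ⟨signTwist_of_dvd hrS dvd_rfl, signTwist_of_dvd hrS dvd_rfl⟩
      · have := finset_not_dvd_of_irreducible hS hr hrm hrS
        rw [signTwist_of_not_dvd this, signTwist_of_not_dvd this]
        rcases Int.units_eq_one_or (ψ (signClass S r)) with h | h <;> simp [h]) hp hm
    (by rw [signTwist_of_not_dvd (finset_not_dvd_of_irreducible hS hp hm hpS)]; simp)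
  have hprod : sievedSeries (signTwist S 1) ∅ * sievedSeries (signTwist S ψ) ∅ =
      (((C (-1 / (Fintype.card E : ℚ)) * R) * ∏ p ∈ S, (1 - X ^ p.natDegree) : ℚ[X]) :
        PowerSeries ℚ) := by
    rw [← hM, h1, Polynomial.coe_mul, Polynomial.coe_mul _ (∏ p ∈ S, _),
      ← one_sub_C_mul_X_mul_sievedSeries_one hS]
    ring
  rw [hprod] at hcoeff
  generalize (C (-1 / (Fintype.card E : ℚ)) * R) * ∏ p ∈ S, (1 - X ^ p.natDegree) = Q at hcoeff
  have := hcoeff (Q.natDegree + 1)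
  rw [Polynomial.coeff_coe, coeff_eq_zero_of_natDegree_lt
    ((Nat.lt_succ_self _).trans_le (Nat.le_mul_of_pos_left _ he))] at this
  norm_num at this

theorem exists_polynomial_mul_sievedSeries (hE : ringChar E ≠ 2)
    (hS : ∀ p ∈ S, Irreducible p ∧ p.Monic) (ψ : (Option S → ℤˣ) →* ℤˣ) :
    ∃ D M : ℚ[X], (D : PowerSeries ℚ) * sievedSeries (signTwist S ψ) ∅ = M ∧
      M.eval (1 / (Fintype.card E : ℚ)) ≠ 0 ∧
      (D.eval (1 / (Fintype.card E : ℚ)) = 0 ↔ ψ = 1) := by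
  classical
  have hq : (1 : ℚ) < Fintype.card E := by exact_mod_cast Fintype.one_lt_card
  by_cases h : ∀ p : S, ψ (Pi.mulSingle (some p) (-1)) = 1
  · have hψ := map_signClass_of_forall_eq_one h
    set u := ψ (Pi.mulSingle none (-1)) with hu
    have hu' : ((u : ℤ) : ℚ) = 1 ∨ ((u : ℤ) : ℚ) = -1 := by
      rcases Int.units_eq_one_or u with h | h <;> simp [h]
    refine ⟨1 - C (((u : ℤ) : ℚ) * Fintype.card E) * X,
      ∏ p ∈ S, (1 - C (((u : ℤ) : ℚ) ^ p.natDegree) * X ^ p.natDegree), ?_, ?_, ?_⟩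
    · rw [← Polynomial.coeToPowerSeries.ringHom_apply, ← Polynomial.coeToPowerSeries.ringHom_apply,
        map_prod]
      have := one_sub_mul_sievedSeries_signTwist hS (ψ := ψ) (ε := ((u : ℤ) : ℚ))
        (fun g => by rw [hψ]; simp)
      simpa only [map_sub, map_one, map_mul, map_pow, coeToPowerSeries.ringHom_apply, coe_C,
        coe_X] using this
    · rw [eval_prod]
      refine Finset.prod_ne_zero_iff.2 fun p hp h0 => ?_
      have hlt : |((u : ℤ) : ℚ) * (1 / (Fintype.card E : ℚ))| < 1 := by
        have h1 : |((u : ℤ) : ℚ)| = 1 := by rcases hu' with h | h <;> simp [h]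
        rw [abs_mul, h1, one_mul, abs_of_pos (by positivity), div_lt_one (by positivity)]
        exact hq
      have h2 := pow_lt_one₀ (abs_nonneg _) hlt (hS p hp).1.natDegree_pos.ne'
      rw [← abs_pow, mul_pow] at h2
      simp only [eval_sub, eval_one, eval_mul, eval_C, eval_pow, eval_X] at h0
      rw [← sub_eq_zero.1 h0] at h2
      simp at h2
    · simp only [eval_sub, eval_one, eval_mul, eval_C, eval_X]
      rw [mul_assoc, mul_one_div_cancel (by positivity), mul_one, sub_eq_zero]
      constructor
      · intro h1
        have hu1 : u = 1 := by
          rcases Int.units_eq_one_or u with h | h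
          · exact h
          · rw [h] at h1; norm_num at h1
        refine MonoidHom.ext fun x => ?_
        rw [← Finset.univ_prod_mulSingle x, map_prod]
        refine Finset.prod_eq_one fun i _ => ?_
        rcases Int.units_eq_one_or (x i) with h2 | h2
        · simp [h2]
        · rw [h2]
          rcases i with _ | p
          · exact hu1
          · exact h p
      · intro h1
        simp [hu, h1]
  · push Not at h
    obtain ⟨p, hp⟩ := h
    have hM : ((PowerSeries.trunc (∏ p ∈ S, p).natDegree (sievedSeries (signTwist S ψ) ∅) : ℚ[X]) :
        PowerSeries ℚ) = sievedSeries (signTwist S ψ) ∅ := by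
      ext n
      rw [Polynomial.coeff_coe, PowerSeries.coeff_trunc]
      split_ifs with hn
      · rfl
      · exact (coeff_sievedSeries_signTwist_eq_zero hE hS
          ((Int.units_eq_one_or _).resolve_left hp) (not_lt.1 hn)).symm
    refine ⟨1, _, by rw [hM]; simp, eval_ne_zero_of_coe_eq_sievedSeries hS hM, ?_⟩
    simp only [eval_one, one_ne_zero, false_iff]
    rintro rfl
    exact hp rfl

/-- Dirichlet's theorem on prime polynomials for prescribed sign classes. -/
theorem exists_monic_irreducible_signClass_eq (hE : ringChar E ≠ 2)
    (hS : ∀ p ∈ S, Irreducible p ∧ p.Monic) {h : Option S → ℤˣ} (hh : h ≠ 1) :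
    ∃ g : E[X], Irreducible g ∧ g.Monic ∧ g ∉ S ∧ signClass S g = h := by
  classical
  by_contra! hno
  have := Fintype.ofFinite ((Option S → ℤˣ) →* ℤˣ)
  let s : Finset ((Option S → ℤˣ) →* ℤˣ) := Finset.univ.filter fun ψ => ψ h = 1
  let t : Finset ((Option S → ℤˣ) →* ℤˣ) := Finset.univ.filter fun ψ => ψ h = -1
  have hprod : ∏ ψ ∈ s, sievedSeries (signTwist S ψ) ∅ =
      ∏ ψ ∈ t, sievedSeries (signTwist S ψ) ∅ := by
    refine prod_sievedSeries_eq (signTwist_one hS)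
      (fun ψ g h hg hh => signTwist_mul hS ψ hg hh) fun p hp hm => ?_
    by_cases hpS : p ∈ S
    · have h1 : ∀ ψ : (Option S → ℤˣ) →* ℤˣ, eulerFactor (signTwist S ψ) p = 1 := by
        intro ψ; simp [eulerFactor, signTwist_of_dvd hpS dvd_rfl]
      rw [Finset.prod_eq_one fun ψ _ => h1 ψ, Finset.prod_eq_one fun ψ _ => h1 ψ]
    · obtain ⟨ψ₀, h1, h2⟩ := exists_character_separating hh (hno p hp hm hpS)
      have hd := finset_not_dvd_of_irreducible hS hp hm hpS
      refine Finset.prod_nbij (ψ₀ * ·) ?_ (mul_right_injective ψ₀).injOn ?_ ?_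
      · intro ψ hψ
        simp only [s, t, Finset.mem_filter, Finset.mem_univ, true_and] at hψ ⊢
        simp [h1, hψ]
      · intro ψ hψ
        simp only [t, Finset.coe_filter, Finset.mem_univ, true_and, Set.mem_ofPred_eq] at hψ
        refine ⟨ψ₀⁻¹ * ψ, ?_, by simp⟩
        simp [s, h1, hψ]
      · intro ψ _
        simp only [eulerFactor, signTwist_of_not_dvd hd, MonoidHom.mul_apply, h2, one_mul]
  choose D M hDM hM hD using exists_polynomial_mul_sievedSeries hE hS
  have key : (∏ ψ ∈ s, M ψ) * ∏ ψ ∈ t, D ψ = (∏ ψ ∈ t, M ψ) * ∏ ψ ∈ s, D ψ := by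
    apply Polynomial.coe_injective
    simp only [← Polynomial.coeToPowerSeries.ringHom_apply, map_mul, map_prod]
    simp only [Polynomial.coeToPowerSeries.ringHom_apply, ← hDM, Finset.prod_mul_distrib, hprod]
    ring
  have := congrArg (eval (1 / (Fintype.card E : ℚ))) key
  rw [eval_mul, eval_mul, eval_prod, eval_prod, eval_prod, eval_prod,
    Finset.prod_eq_zero (s := s) (f := fun ψ => eval _ (D ψ)) (i := 1) (by simp [s])
      ((hD 1).2 rfl), mul_zero] at this
  rcases mul_eq_zero.1 this with h0 | h0
  · obtain ⟨ψ, -, h1⟩ := Finset.prod_eq_zero_iff.1 h0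
    exact hM ψ h1
  · obtain ⟨ψ, hψ, h1⟩ := Finset.prod_eq_zero_iff.1 h0
    rw [(hD ψ).1 h1] at hψ
    simp [t] at hψ

/-- There is a monic polynomial, irreducible or equal to one, with prescribed quadratic symbols at
finitely many primes and prescribed parity of the degree. -/
theorem exists_monic_quadSymbol_eq (hE : ringChar E ≠ 2) (hS : ∀ p ∈ S, Irreducible p ∧ p.Monic)
    {η : E[X] → ℤ} (hη : ∀ p ∈ S, η p = 1 ∨ η p = -1) (e : ℕ) :
    ∃ g : E[X], g.Monic ∧ (g = 1 ∨ Irreducible g) ∧ (∀ p ∈ S, quadSymbol p g = η p) ∧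
      g.natDegree % 2 = e % 2 := by
  let h : Option S → ℤˣ
    | none => (-1) ^ e
    | some p => if η p = 1 then 1 else -1
  obtain ⟨g, hgm, hg, hgS, hcls⟩ : ∃ g : E[X], g.Monic ∧ (g = 1 ∨ Irreducible g) ∧
      (∀ p ∈ S, ¬ p ∣ g) ∧ signClass S g = h := by
    by_cases hh : h = 1
    · exact ⟨1, monic_one, .inl rfl, fun p hp => (hS p hp).1.not_dvd_one,
        by rw [signClass_one hS, hh]⟩
    · obtain ⟨g, hg, hgm, hgS, hcls⟩ := exists_monic_irreducible_signClass_eq hE hS hh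
      exact ⟨g, hgm, .inr hg, finset_not_dvd_of_irreducible hS hg hgm hgS, hcls⟩
  refine ⟨g, hgm, hg, fun p hp => ?_, ?_⟩
  · have h1 := congrFun hcls (some ⟨p, hp⟩)
    simp only [signClass, h] at h1
    rcases quadSymbol_eq_one_or_neg_one (hgS p hp) with h2 | h2 <;>
      rcases hη p hp with h3 | h3 <;> simp [h2, h3] at h1 ⊢
  · have h1 := congrFun hcls none
    simp only [signClass, h] at h1
    have h2 : Even g.natDegree ↔ Even e := by
      rw [← neg_one_pow_eq_one_iff_even (R := ℤˣ) (by decide), h1,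
        neg_one_pow_eq_one_iff_even (by decide)]
    rw [Nat.even_iff, Nat.even_iff] at h2
    omega

end Dirichlet

section LocalRepresentation

theorem exists_binary_eq_of_isotropic {L : Type*} [Field L] (h2 : (2 : L) ≠ 0) {c d x y : L}
    (hc : c ≠ 0) (hd : d ≠ 0) (hxy : x ≠ 0 ∨ y ≠ 0) (h : c * x ^ 2 + d * y ^ 2 = 0) (e : L) :
    ∃ z w : L, c * z ^ 2 + d * w ^ 2 = e := by
  have hy : y ≠ 0 := by
    rintro rfl
    simp_all
  have hx : x ≠ 0 := by
    rintro rfl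
    simp_all
  refine ⟨(e / c + 1) / 2, (e / c - 1) / 2 * (y / x), ?_⟩
  have h' : d * y ^ 2 = -(c * x ^ 2) := by linear_combination h
  have : d * ((e / c - 1) / 2 * (y / x)) ^ 2 = -c * ((e / c - 1) / 2) ^ 2 := by
    rw [mul_pow, div_pow y x, mul_left_comm, ← mul_div_assoc, h']
    field_simp
  rw [this]
  field_simp
  ring

/-- An isotropic quaternary form vanishes at a point where its first binary half does not. -/
theorem exists_isotropic_vector_ne_zero {L : Type*} [Field L] (h2 : (2 : L) ≠ 0) {c : Fin 4 → L}
    (hc : ∀ i, c i ≠ 0) (h : IsotropicDiag c) :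
    ∃ x : Fin 4 → L, ∑ i, c i * x i ^ 2 = 0 ∧ c 0 * x 0 ^ 2 + c 1 * x 1 ^ 2 ≠ 0 := by
  obtain ⟨x, hx0, hx⟩ := h
  by_cases hτ : c 0 * x 0 ^ 2 + c 1 * x 1 ^ 2 = 0
  swap
  · exact ⟨x, hx, hτ⟩
  rw [Fin.sum_univ_four] at hx
  by_cases h01 : x 0 ≠ 0 ∨ x 1 ≠ 0
  · obtain ⟨z, w, hzw⟩ :=
      exists_binary_eq_of_isotropic h2 (hc 0) (hc 1) h01 hτ (-c 2)
    refine ⟨![z, w, 1, 0], ?_, ?_⟩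
    · simp [Fin.sum_univ_four, hzw]
    · simp [hzw, hc 2]
  · push Not at h01
    have h23 : x 2 ≠ 0 ∨ x 3 ≠ 0 := by
      by_contra! h23
      apply hx0
      ext i
      fin_cases i <;> simp [h01, h23]
    obtain ⟨z, w, hzw⟩ := exists_binary_eq_of_isotropic h2 (hc 2) (hc 3) h23
      (by linear_combination hx - hτ) (-c 0)
    refine ⟨![1, 0, z, w], ?_, ?_⟩
    · simp only [Fin.sum_univ_four]
      simp
      linear_combination hzw
    · simp [hc 0]

/-- A zero over the completion is approximated by vectors over the base field. -/
theorem exists_valuation_lt_of_isotropicCompletion {K : Type*} [Field K] (h2 : (2 : K) ≠ 0)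
    (v : Valuation K (WithZero (Multiplicative ℤ))) {a : Fin 4 → K} (ha : ∀ i, a i ≠ 0)
    (h : IsotropicCompletion v a) :
    ∃ y : Fin 4 → K, a 0 * y 0 ^ 2 + a 1 * y 1 ^ 2 ≠ 0 ∧
      v (∑ i, a i * y i ^ 2) < v (a 0 * y 0 ^ 2 + a 1 * y 1 ^ 2) := by
  let : Valued K (WithZero (Multiplicative ℤ)) := Valued.mk' v
  set L := UniformSpace.Completion K
  let ι : K →+* L := UniformSpace.Completion.coeRingHom
  have hι : ∀ x : K, ι x = UniformSpace.Completion.coe' x := fun _ => rfl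
  have hιv : ∀ x : K, Valued.v (ι x) = v x := fun x => Valued.valuedCompletion_apply x
  have h2' : (2 : L) ≠ 0 := by
    rw [← map_ofNat ι 2]
    exact (map_ne_zero ι).2 h2
  obtain ⟨x, hx, hτ⟩ := exists_isotropic_vector_ne_zero (c := fun i => ι (a i)) h2'
    (fun i => (map_ne_zero ι).2 (ha i)) h
  let f : (Fin 4 → L) → L := fun x => ∑ i, ι (a i) * x i ^ 2
  let g : (Fin 4 → L) → L := fun x => ι (a 0) * x 0 ^ 2 + ι (a 1) * x 1 ^ 2
  have hf : Continuous f := by fun_prop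
  have hg : Continuous g := by fun_prop
  have hgx : (Valued.v (g x) : WithZero (Multiplicative ℤ)) ≠ 0 := (Valuation.ne_zero_iff _).2 hτ
  have hU : {z : L | Valued.v z = Valued.v (g x)} ∈ nhds (g x) := Valued.locally_const hgx
  have hV : {z : L | Valued.v z < Valued.v (g x)} ∈ nhds (f x) := by
    rw [show f x = 0 from hx]
    rw [Valued.mem_nhds_zero]
    have hr : Valued.v.restrict (g x) ≠ 0 := (Valuation.ne_zero_iff _).2 hτ
    refine ⟨Units.mk0 _ hr, fun z hz => ?_⟩
    simpa [Valuation.restrict_lt_iff] using hz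
  have hmem := Filter.inter_mem (hg.continuousAt.preimage_mem_nhds hU)
    (hf.continuousAt.preimage_mem_nhds hV)
  have hdense : DenseRange (Pi.map fun _ : Fin 4 => (UniformSpace.Completion.coe' : K → L)) :=
    DenseRange.piMap fun _ => UniformSpace.Completion.denseRange_coe
  obtain ⟨_, ⟨y, rfl⟩, hy1, hy2⟩ := hdense.inter_nhds_nonempty hmem
  have hgy : g (Pi.map (fun _ : Fin 4 => (UniformSpace.Completion.coe' : K → L)) y) =
      ι (a 0 * y 0 ^ 2 + a 1 * y 1 ^ 2) := by
    simp [g, ← hι]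
  have hfy : f (Pi.map (fun _ : Fin 4 => (UniformSpace.Completion.coe' : K → L)) y) =
      ι (∑ i, a i * y i ^ 2) := by
    simp [f, ← hι]
  simp only [Set.mem_preimage, Set.mem_ofPred_eq, hgy, hfy, hιv] at hy1 hy2
  rw [← hy1] at hy2 hgx
  exact ⟨y, (Valuation.ne_zero_iff _).1 hgx, hy2⟩

end LocalRepresentation

section RationalFunctionValuations

variable {E : Type*} [Field E]

theorem exists_polynomial_valuation_lt (v : Valuation (RatFunc E) (WithZero (Multiplicative ℤ)))
    {b : Fin 4 → E[X]} {z : Fin 4 → RatFunc E}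
    (h0 : algebraMap E[X] (RatFunc E) (b 0) * z 0 ^ 2 +
      algebraMap E[X] (RatFunc E) (b 1) * z 1 ^ 2 ≠ 0)
    (hv : v (∑ i, algebraMap E[X] (RatFunc E) (b i) * z i ^ 2) <
      v (algebraMap E[X] (RatFunc E) (b 0) * z 0 ^ 2 +
        algebraMap E[X] (RatFunc E) (b 1) * z 1 ^ 2)) :
    ∃ y : Fin 4 → E[X], b 0 * y 0 ^ 2 + b 1 * y 1 ^ 2 ≠ 0 ∧
      v (algebraMap E[X] (RatFunc E) (∑ i, b i * y i ^ 2)) <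
        v (algebraMap E[X] (RatFunc E) (b 0 * y 0 ^ 2 + b 1 * y 1 ^ 2)) := by
  obtain ⟨⟨d, hd⟩, hdz⟩ := IsLocalization.exist_integer_multiples_of_finite (nonZeroDivisors E[X]) z
  choose y hy using hdz
  have hd0 : algebraMap E[X] (RatFunc E) d ≠ 0 :=
    IsFractionRing.to_map_ne_zero_of_mem_nonZeroDivisors hd
  have hy' : ∀ i, algebraMap E[X] (RatFunc E) (y i) = algebraMap E[X] (RatFunc E) d * z i := by
    intro i
    rw [hy i, Algebra.smul_def]
  have hτ : algebraMap E[X] (RatFunc E) (b 0 * y 0 ^ 2 + b 1 * y 1 ^ 2) =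
      algebraMap E[X] (RatFunc E) d ^ 2 * (algebraMap E[X] (RatFunc E) (b 0) * z 0 ^ 2 +
        algebraMap E[X] (RatFunc E) (b 1) * z 1 ^ 2) := by
    simp only [map_add, map_mul, map_pow, hy']
    ring
  have hσ : algebraMap E[X] (RatFunc E) (∑ i, b i * y i ^ 2) =
      algebraMap E[X] (RatFunc E) d ^ 2 *
        (∑ i, algebraMap E[X] (RatFunc E) (b i) * z i ^ 2) := by
    simp only [map_sum, map_mul, map_pow, hy', Finset.mul_sum]
    exact Finset.sum_congr rfl fun i _ => by ring
  have hd2 := pow_ne_zero 2 hd0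
  refine ⟨y, fun h => mul_ne_zero hd2 h0 (by rw [← hτ, h, map_zero]), ?_⟩
  rw [hτ, hσ, map_mul v, map_mul v]
  exact mul_lt_mul_of_pos_left hv (zero_lt_iff.2 ((Valuation.ne_zero_iff _).2 hd2))

theorem exists_valuation_of_irreducible {p : E[X]} (hp : Irreducible p) :
    ∃ v : Valuation (RatFunc E) (WithZero (Multiplicative ℤ)), IsZValuationTrivialOnBase E v ∧
      ∀ f g : E[X], v (algebraMap E[X] (RatFunc E) f) < v (algebraMap E[X] (RatFunc E) g) →
        p ^ (multiplicity p g + 1) ∣ f := by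
  let w : IsDedekindDomain.HeightOneSpectrum E[X] :=
    ⟨Ideal.span {p}, (Ideal.span_singleton_prime hp.ne_zero).2 hp.prime,
      by simpa using hp.ne_zero⟩
  refine ⟨w.valuation (RatFunc E), ⟨w.valuation_surjective _, fun a => ?_⟩, fun f g hfg => ?_⟩
  · have ha : ∀ b : E, w.valuation (RatFunc E) (algebraMap E (RatFunc E) b) ≤ 1 := by
      intro b
      rw [IsScalarTower.algebraMap_apply E E[X] (RatFunc E)]
      exact w.valuation_le_one _
    refine le_antisymm (ha a) ?_
    have h1 : w.valuation (RatFunc E) (algebraMap E (RatFunc E) a) *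
        w.valuation (RatFunc E) (algebraMap E (RatFunc E) (a⁻¹ : Eˣ)) = 1 := by
      rw [← map_mul, ← map_mul, Units.mul_inv, map_one, map_one]
    calc 1 = _ := h1.symm
      _ ≤ w.valuation (RatFunc E) (algebraMap E (RatFunc E) a) * 1 := mul_le_mul_right (ha _) _
      _ = _ := mul_one _
  · rw [w.valuation_of_algebraMap, w.valuation_of_algebraMap] at hfg
    have hdvd : ∀ (h : E[X]) (n : ℕ), w.intValuation h ≤ WithZero.exp (-(n : ℤ)) ↔ p ^ n ∣ h := by
      intro h n
      rw [w.intValuation_le_pow_iff_mem, Ideal.span_singleton_pow, Ideal.mem_span_singleton]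
    have hlt := hfg.trans_le ((hdvd g _).2 (pow_multiplicity_dvd p g))
    rw [← hdvd]
    rcases eq_or_ne f 0 with rfl | hf
    · simp
    rw [w.intValuation_if_neg hf, WithZero.exp_lt_exp] at hlt
    rw [w.intValuation_if_neg hf, WithZero.exp_le_exp]
    push_cast
    omega

theorem exists_valuation_degree :
    ∃ v : Valuation (RatFunc E) (WithZero (Multiplicative ℤ)), IsZValuationTrivialOnBase E v ∧
      ∀ f g : E[X], v (algebraMap E[X] (RatFunc E) f) < v (algebraMap E[X] (RatFunc E) g) →
        f.degree < g.degree := by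
  classical
  refine ⟨RatFunc.inftyValuation E, ⟨fun x => ?_, fun a => ?_⟩, fun f g hfg => ?_⟩
  · induction x with
    | zero => exact ⟨0, map_zero _⟩
    | coe m => exact ⟨RatFunc.X ^ m.toAdd, RatFunc.inftyValuation.X_zpow E _⟩
  · exact RatFunc.inftyValuation.C E a.ne_zero
  · have hg : g ≠ 0 := by
      rintro rfl
      simp at hfg
    rcases eq_or_ne f 0 with rfl | hf
    · simpa [bot_lt_iff_ne_bot] using hg
    rw [RatFunc.inftyValuation_apply, RatFunc.inftyValuation_apply,
      RatFunc.inftyValuation.polynomial E hf, RatFunc.inftyValuation.polynomial E hg,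
      WithZero.exp_lt_exp] at hfg
    exact degree_lt_degree (by exact_mod_cast hfg)

end RationalFunctionValuations

section CommonValue

variable {E : Type*} [Field E]

theorem tameSymbol_common_value [Fintype E] {p : E[X]} (hp : Irreducible p) {b y : Fin 4 → E[X]}
    (hb : ∀ i, b i ≠ 0) (hτ : b 0 * y 0 ^ 2 + b 1 * y 1 ^ 2 ≠ 0)
    (hdvd : p ^ (multiplicity p (b 0 * y 0 ^ 2 + b 1 * y 1 ^ 2) + 1) ∣ ∑ i, b i * y i ^ 2) :
    tameSymbol p (-(b 0 * b 1)) (b 0 * (b 0 * y 0 ^ 2 + b 1 * y 1 ^ 2)) = 1 ∧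
      tameSymbol p (-(b 2 * b 3)) (-b 2 * (b 0 * y 0 ^ 2 + b 1 * y 1 ^ 2)) = 1 := by
  have hA : -(b 0 * b 1) ≠ 0 := neg_ne_zero.2 (mul_ne_zero (hb 0) (hb 1))
  have hC : -(b 2 * b 3) ≠ 0 := neg_ne_zero.2 (mul_ne_zero (hb 2) (hb 3))
  have h2 : -b 2 ≠ 0 := neg_ne_zero.2 (hb 2)
  refine ⟨tameSymbol_eq_one_of_sq_sub hp hA (mul_ne_zero (hb 0) hτ) (r := b 0 * y 0) (s := y 1)
    (by ring), ?_⟩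
  set τ := b 0 * y 0 ^ 2 + b 1 * y 1 ^ 2
  let σ := -(b 2 * y 2 ^ 2 + b 3 * y 3 ^ 2)
  have hτσ : ∑ i, b i * y i ^ 2 = τ - σ := by
    simp only [Fin.sum_univ_four, τ, σ]
    ring
  rw [hτσ] at hdvd
  have hσ : σ ≠ 0 := by
    intro h
    rw [h, sub_zero] at hdvd
    exact (FiniteMultiplicity.of_prime_left hp.prime hτ).not_pow_dvd_of_multiplicity_lt
      (Nat.lt_succ_self _) hdvd
  rw [tameSymbol_mul_right hp hC h2 hτ, tameSymbol_eq_of_pow_dvd_sub hp hτ hC hdvd,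
    ← tameSymbol_mul_right hp hC h2 hσ]
  exact tameSymbol_eq_one_of_sq_sub hp hC (mul_ne_zero h2 hσ) (r := b 2 * y 2) (s := y 3)
    (by simp only [σ]; ring)

variable [Fintype E] [DecidableEq E]

theorem tameSymbolInfty_congr {x y z : E[X]} (hx : x ≠ 0) (hlc : y.leadingCoeff = z.leadingCoeff)
    (hdeg : y.natDegree % 2 = z.natDegree % 2) : tameSymbolInfty x y = tameSymbolInfty x z := by
  unfold tameSymbolInfty
  rw [hlc, pow_eq_pow_of_mod_two (quadraticChar_mul_self (leadingCoeff_ne_zero.2 hx)) hdeg,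
    pow_eq_pow_of_mod_two (a := quadraticChar E (-1))
      (quadraticChar_mul_self (neg_ne_zero.2 one_ne_zero))
      ((Nat.ModEq.refl x.natDegree).mul hdeg)]

theorem tameSymbolInfty_eq_one_of_sq_sub (hE : ringChar E ≠ 2) {A B r s : E[X]} (hA : A ≠ 0)
    (hB : B ≠ 0) (h : r ^ 2 - A * s ^ 2 = B) : tameSymbolInfty A B = 1 := by
  obtain ⟨S, hS⟩ := exists_finset_monic_irreducible_dvd (mul_ne_zero hA hB)
  rw [← prod_tameSymbol hE (fun p hp => ⟨((hS p).1 hp).1, ((hS p).1 hp).2.1⟩) hA hB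
    (fun r h1 h2 h3 => (hS r).2 ⟨h1, h2, h3.mul_right B⟩)
    (fun r h1 h2 h3 => (hS r).2 ⟨h1, h2, h3.mul_left A⟩)]
  exact Finset.prod_eq_one fun p hp => tameSymbol_eq_one_of_sq_sub ((hS p).1 hp).1 hA hB h

theorem tameSymbolInfty_common_value (hE : ringChar E ≠ 2) {b y : Fin 4 → E[X]}
    (hb : ∀ i, b i ≠ 0) (hτ : b 0 * y 0 ^ 2 + b 1 * y 1 ^ 2 ≠ 0)
    (hdeg : (∑ i, b i * y i ^ 2).degree < (b 0 * y 0 ^ 2 + b 1 * y 1 ^ 2).degree) :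
    tameSymbolInfty (-(b 0 * b 1)) (b 0 * (b 0 * y 0 ^ 2 + b 1 * y 1 ^ 2)) = 1 ∧
      tameSymbolInfty (-(b 2 * b 3)) (-b 2 * (b 0 * y 0 ^ 2 + b 1 * y 1 ^ 2)) = 1 := by
  have hA : -(b 0 * b 1) ≠ 0 := neg_ne_zero.2 (mul_ne_zero (hb 0) (hb 1))
  have hC : -(b 2 * b 3) ≠ 0 := neg_ne_zero.2 (mul_ne_zero (hb 2) (hb 3))
  have h2 : -b 2 ≠ 0 := neg_ne_zero.2 (hb 2)
  refine ⟨tameSymbolInfty_eq_one_of_sq_sub hE hA (mul_ne_zero (hb 0) hτ) (r := b 0 * y 0)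
    (s := y 1) (by ring), ?_⟩
  set τ := b 0 * y 0 ^ 2 + b 1 * y 1 ^ 2
  let σ := -(b 2 * y 2 ^ 2 + b 3 * y 3 ^ 2)
  have hσeq : σ = τ - ∑ i, b i * y i ^ 2 := by
    simp only [Fin.sum_univ_four, τ, σ]
    ring
  have hσdeg : σ.degree = τ.degree := by rw [hσeq, degree_sub_eq_left_of_degree_lt hdeg]
  have hσ : σ ≠ 0 := by
    rw [← degree_ne_bot, hσdeg]
    exact degree_ne_bot.2 hτ
  have hlc : τ.leadingCoeff = σ.leadingCoeff := by rw [hσeq, leadingCoeff_sub_of_degree_lt hdeg]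
  rw [tameSymbolInfty_mul_right h2 hτ,
    tameSymbolInfty_congr hC hlc (by rw [natDegree_eq_natDegree hσdeg]),
    ← tameSymbolInfty_mul_right h2 hσ]
  exact tameSymbolInfty_eq_one_of_sq_sub hE hC (mul_ne_zero h2 hσ) (r := b 2 * y 2) (s := y 3)
    (by simp only [σ]; ring)

/-- Local solutions `t` of the symbol conditions can be replaced by a single global one. -/
theorem exists_tameSymbol_eq_one (hE : ringChar E ≠ 2) {A C α γ : E[X]} (hA : A ≠ 0) (hC : C ≠ 0)
    (hα : α ≠ 0) (hγ : γ ≠ 0)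
    (hloc : ∀ p : E[X], Irreducible p → p.Monic → ∃ t : E[X], t ≠ 0 ∧
      tameSymbol p A (α * t) = 1 ∧ tameSymbol p C (γ * t) = 1)
    (hinf : ∃ t : E[X], t ≠ 0 ∧ tameSymbolInfty A (α * t) = 1 ∧ tameSymbolInfty C (γ * t) = 1) :
    ∃ t : E[X], t ≠ 0 ∧ ∀ p : E[X], Irreducible p → p.Monic →
      tameSymbol p A (α * t) = 1 ∧ tameSymbol p C (γ * t) = 1 := by
  obtain ⟨s, hs, hsA, hsC⟩ := hinf
  have hloc' : ∀ p : E[X], ∃ (n : ℕ) (u : E[X]), Irreducible p → p.Monic → ¬ p ∣ u ∧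
      tameSymbol p A (α * (p ^ n * u)) = 1 ∧ tameSymbol p C (γ * (p ^ n * u)) = 1 := by
    intro p
    by_cases hp : Irreducible p ∧ p.Monic
    · obtain ⟨t, ht, h1, h2⟩ := hloc p hp.1 hp.2
      obtain ⟨n, u, rfl, hu⟩ := exists_eq_pow_mul_not_dvd hp.1 ht
      exact ⟨n, u, fun _ _ => ⟨hu, h1, h2⟩⟩
    · exact ⟨0, 0, fun h1 h2 => absurd ⟨h1, h2⟩ hp⟩
  choose n u hnu using hloc'
  obtain ⟨S, hS⟩ := exists_finset_monic_irreducible_dvd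
    (mul_ne_zero (mul_ne_zero hA hC) (mul_ne_zero hα hγ))
  have hS' : ∀ p ∈ S, Irreducible p ∧ p.Monic := fun p hp => ⟨((hS p).1 hp).1, ((hS p).1 hp).2.1⟩
  have hlam : s.leadingCoeff ≠ 0 := leadingCoeff_ne_zero.2 hs
  let R : E[X] → E[X] := fun q => Polynomial.C s.leadingCoeff * ∏ p ∈ S.erase q, p ^ n p
  have hprod : ∀ (U : Finset E[X]) (q : E[X]), U ⊆ S → q ∉ U → Irreducible q → q.Monic →
      ¬ q ∣ ∏ p ∈ U, p ^ n p := by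
    intro U q hU hqU hq hqm hdvd
    obtain ⟨p, hpU, hqp⟩ := (hq.prime.dvd_finsetProd_iff _).1 hdvd
    have hp := hS' p (hU hpU)
    exact not_dvd_of_monic_irreducible_ne hq hqm hp.1 hp.2 (by rintro rfl; exact hqU hpU)
      (hq.prime.dvd_of_dvd_pow hqp)
  have hR : ∀ q ∈ S, ¬ q ∣ R q := by
    intro q hq hdvd
    rcases (hS' q hq).1.prime.dvd_or_dvd hdvd with h | h
    · exact not_dvd_C (hS' q hq).1 hlam h
    · exact hprod _ q (Finset.erase_subset _ _) (Finset.notMem_erase _ _) (hS' q hq).1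
        (hS' q hq).2 h
  have hu : ∀ q ∈ S, ¬ q ∣ u q := fun q hq => (hnu q (hS' q hq).1 (hS' q hq).2).1
  obtain ⟨g, hgm, hg, hgS, hgdeg⟩ := exists_monic_quadSymbol_eq hE hS'
    (η := fun q => quadSymbol q (u q * R q))
    (fun q hq => quadSymbol_eq_one_or_neg_one fun hdvd =>
      ((hS' q hq).1.prime.dvd_or_dvd hdvd).elim (hu q hq) (hR q hq))
    (s.natDegree + (∏ p ∈ S, p ^ n p).natDegree)
  have hTm : (∏ p ∈ S, p ^ n p).Monic := monic_prod_of_monic _ _ fun p hp => (hS' p hp).2.pow _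
  set T := ∏ p ∈ S, p ^ n p
  have hgS0 : ∀ q ∈ S, ¬ q ∣ g := by
    intro q hq hdvd
    rw [← quadSymbol_eq_zero_iff, hgS q hq, quadSymbol_eq_zero_iff] at hdvd
    exact ((hS' q hq).1.prime.dvd_or_dvd hdvd).elim (hu q hq) (hR q hq)
  let t := Polynomial.C s.leadingCoeff * T * g
  have ht : t ≠ 0 := mul_ne_zero (mul_ne_zero (C_ne_zero.2 hlam) hTm.ne_zero) hgm.ne_zero
  have htlc : t.leadingCoeff = s.leadingCoeff := by
    simp [t, leadingCoeff_mul, hTm.leadingCoeff, hgm.leadingCoeff]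
  have htdeg : t.natDegree % 2 = s.natDegree % 2 := by
    have : t.natDegree = T.natDegree + g.natDegree := by
      simp only [t]
      rw [mul_assoc, natDegree_C_mul hlam, natDegree_mul hTm.ne_zero hgm.ne_zero]
    omega
  have key : ∀ B β : E[X], B ≠ 0 → β ≠ 0 →
      (∀ q : E[X], Irreducible q → q.Monic → q ∣ B ∨ q ∣ β → q ∈ S) →
      (∀ q ∈ S, tameSymbol q B (β * (q ^ n q * u q)) = 1) → tameSymbolInfty B (β * s) = 1 →
      ∀ q : E[X], Irreducible q → q.Monic → tameSymbol q B (β * t) = 1 := by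
    intro B β hB hβ hBS hBloc hBinf
    have hmem : ∀ q ∈ S, tameSymbol q B (β * t) = 1 := by
      intro q hq
      have hqi := (hS' q hq).1
      rw [← hBloc q hq, tameSymbol_mul_right hqi hB hβ ht, tameSymbol_mul_right hqi hB hβ
        (mul_ne_zero (pow_ne_zero _ hqi.ne_zero) (by rintro h; exact hu q hq (h ▸ dvd_zero q)))]
      congr 1
      have htq : t = q ^ n q * (R q * g) := by
        simp only [t, R, T]
        rw [← Finset.mul_prod_erase S _ hq]
        ring
      rw [htq]
      refine tameSymbol_congr hqi (fun hdvd => (hqi.prime.dvd_or_dvd hdvd).elim (hR q hq)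
        (hgS0 q hq)) (hu q hq) hB rfl ?_
      rw [quadSymbol_mul hqi (R q) g, hgS q hq, quadSymbol_mul hqi (u q) (R q)]
      linear_combination quadSymbol q (u q) * quadSymbol_mul_self (hR q hq)
    have hnot : ∀ q : E[X], Irreducible q → q.Monic → q ∉ S → q ≠ g →
        tameSymbol q B (β * t) = 1 := by
      intro q hq hqm hqS hqg
      refine tameSymbol_eq_one_of_not_dvd hq (fun h => hqS (hBS q hq hqm (.inl h))) fun h => ?_
      rcases hq.prime.dvd_or_dvd h with h | h
      · exact hqS (hBS q hq hqm (.inr h))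
      rcases hq.prime.dvd_or_dvd h with h | h
      · rcases hq.prime.dvd_or_dvd h with h | h
        · exact not_dvd_C hq hlam h
        · exact hprod S q subset_rfl hqS hq hqm h
      · rcases hg with rfl | hgi
        · exact hq.not_isUnit (isUnit_of_dvd_one h)
        · exact not_dvd_of_monic_irreducible_ne hq hqm hgi hgm hqg h
    intro q hq hqm
    by_cases hqS : q ∈ S
    · exact hmem q hqS
    by_cases hqg : q ≠ g
    · exact hnot q hq hqm hqS hqg
    push Not at hqg
    subst hqg
    have hβt : β * t ≠ 0 := mul_ne_zero hβ ht
    obtain ⟨S₁, hS₁⟩ := exists_finset_monic_irreducible_dvd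
      (mul_ne_zero hB (mul_ne_zero hβt hqm.ne_zero))
    have hrec := prod_tameSymbol hE (fun p hp => ⟨((hS₁ p).1 hp).1, ((hS₁ p).1 hp).2.1⟩) hB hβt
      (fun r h1 h2 h3 => (hS₁ r).2 ⟨h1, h2, h3.mul_right _⟩)
      (fun r h1 h2 h3 => (hS₁ r).2 ⟨h1, h2, (h3.mul_right _).mul_left _⟩)
    rw [tameSymbolInfty_mul_right hβ ht, tameSymbolInfty_congr hB htlc htdeg,
      ← tameSymbolInfty_mul_right hβ hs, hBinf, Finset.prod_eq_single_of_mem q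
        ((hS₁ q).2 ⟨hq, hqm, (dvd_mul_left q _).mul_left _⟩)] at hrec
    · exact hrec
    · intro r hr hrq
      obtain ⟨hri, hrm, -⟩ := (hS₁ r).1 hr
      by_cases hrS : r ∈ S
      · exact hmem r hrS
      · exact hnot r hri hrm hrS hrq
  have hSmem : ∀ q : E[X], Irreducible q → q.Monic → q ∣ A * C * (α * γ) → q ∈ S :=
    fun q h1 h2 h3 => (hS q).2 ⟨h1, h2, h3⟩
  refine ⟨t, ht, fun p hp hpm => ⟨key A α hA hα ?_ ?_ hsA p hp hpm,
    key C γ hC hγ ?_ ?_ hsC p hp hpm⟩⟩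
  · rintro q h1 h2 (h | h)
    · exact hSmem q h1 h2 ((h.mul_right _).mul_right _)
    · exact hSmem q h1 h2 ((h.mul_right _).mul_left _)
  · exact fun q hq => (hnu q (hS' q hq).1 (hS' q hq).2).2.1
  · rintro q h1 h2 (h | h)
    · exact hSmem q h1 h2 ((h.mul_left _).mul_right _)
    · exact hSmem q h1 h2 ((h.mul_left _).mul_left _)
  · exact fun q hq => (hnu q (hS' q hq).1 (hS' q hq).2).2.2

end CommonValue

section Assembly

variable {E : Type*} [Field E]

/-- Two conics sharing the value `t` give a zero of the quaternary form. -/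
theorem isotropicDiag_of_isNormSolvable {b : Fin 4 → E[X]} (hb : ∀ i, b i ≠ 0) {t : E[X]}
    (ht : t ≠ 0) (h1 : IsNormSolvable (-(b 0 * b 1)) (b 0 * t))
    (h2 : IsNormSolvable (-(b 2 * b 3)) (-b 2 * t)) : IsotropicDiag b := by
  obtain ⟨x, y, z, h0, h⟩ := h1
  obtain ⟨x', y', z', h0', h'⟩ := h2
  rcases eq_or_ne z 0 with rfl | hz
  · refine ⟨![x, b 0 * y, 0, 0], fun hx => ?_, ?_⟩
    · have e0 := congrFun hx 0
      have e1 := congrFun hx 1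
      simp_all
    · simp only [Fin.sum_univ_four]
      simp
      linear_combination b 0 * h
  rcases eq_or_ne z' 0 with rfl | hz'
  · refine ⟨![0, 0, x', b 2 * y'], fun hx => ?_, ?_⟩
    · have e0 := congrFun hx 2
      have e1 := congrFun hx 3
      simp_all
    · simp only [Fin.sum_univ_four]
      simp
      linear_combination b 2 * h'
  refine ⟨![x * (b 2 * z'), b 0 * y * (b 2 * z'), x' * (b 0 * z), b 2 * y' * (b 0 * z)],
    fun hx => ?_, ?_⟩
  · have e0 := congrFun hx 0
    have e1 := congrFun hx 1
    simp_all
  · simp only [Fin.sum_univ_four]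
    simp
    linear_combination b 0 * (b 2 * z') ^ 2 * h + b 2 * (b 0 * z) ^ 2 * h'

theorem isotropicDiag_of_polynomial {a : Fin 4 → RatFunc E} {b : Fin 4 → E[X]}
    {d : Fin 4 → RatFunc E} (hd : ∀ i, d i ≠ 0)
    (hab : ∀ i, algebraMap E[X] (RatFunc E) (b i) = a i * d i ^ 2) (h : IsotropicDiag b) :
    IsotropicDiag a := by
  obtain ⟨x, hx, h⟩ := h
  refine ⟨fun i => d i * algebraMap E[X] (RatFunc E) (x i), fun h0 => hx (funext fun i => ?_), ?_⟩
  · simpa [hd i] using congrFun h0 i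
  · rw [← map_zero (algebraMap E[X] (RatFunc E)), ← h, map_sum]
    refine Finset.sum_congr rfl fun i _ => ?_
    rw [map_mul, map_pow, hab]
    ring

end Assembly

/-- Over a finite field `E` of odd cardinality, 4-dimensional quadratic forms over `E(X)`
satisfy the local-global principle for isotropy with respect to ℤ-valuations trivial on `E`. -/
theorem statement4 (E : Type*) [Field E] [Fintype E] (hcard : Odd (Fintype.card E))
    (a : Fin 4 → RatFunc E) (ha : ∀ i, a i ≠ 0)
    (hloc : ∀ v : Valuation (RatFunc E) (WithZero (Multiplicative ℤ)),
      IsZValuationTrivialOnBase E v → IsotropicCompletion v a) :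
    IsotropicDiag a := by
  classical
  have hE : ringChar E ≠ 2 := fun h => by
    have := FiniteField.even_card_iff_char_two.1 h
    grind
  have h2 : (2 : RatFunc E) ≠ 0 := by
    rw [← map_ofNat (algebraMap E (RatFunc E)) 2]
    exact (_root_.map_ne_zero _).2 (Ring.two_ne_zero hE)
  let b : Fin 4 → E[X] := fun i => (a i).num * (a i).denom
  let d : Fin 4 → RatFunc E := fun i => algebraMap E[X] (RatFunc E) (a i).denom
  have hd : ∀ i, d i ≠ 0 := fun i => RatFunc.algebraMap_ne_zero (a i).denom_ne_zero
  have hb : ∀ i, b i ≠ 0 := fun i =>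
    mul_ne_zero (RatFunc.num_ne_zero (ha i)) (a i).denom_ne_zero
  have hab : ∀ i, algebraMap E[X] (RatFunc E) (b i) = a i * d i ^ 2 := by
    intro i
    conv_rhs => rw [← RatFunc.num_div_denom (a i)]
    have := hd i
    simp only [b, d, map_mul] at this ⊢
    field_simp
  have hval : ∀ v : Valuation (RatFunc E) (WithZero (Multiplicative ℤ)),
      IsZValuationTrivialOnBase E v → ∃ y : Fin 4 → E[X], b 0 * y 0 ^ 2 + b 1 * y 1 ^ 2 ≠ 0 ∧
        v (algebraMap E[X] (RatFunc E) (∑ i, b i * y i ^ 2)) <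
          v (algebraMap E[X] (RatFunc E) (b 0 * y 0 ^ 2 + b 1 * y 1 ^ 2)) := by
    intro v hv
    obtain ⟨y, hy0, hy⟩ := exists_valuation_lt_of_isotropicCompletion h2 v ha (hloc v hv)
    have hby : ∀ i, algebraMap E[X] (RatFunc E) (b i) * (y i / d i) ^ 2 = a i * y i ^ 2 := by
      intro i
      rw [hab]
      have := hd i
      field_simp
    exact exists_polynomial_valuation_lt v (z := fun i => y i / d i) (by simpa only [hby] using hy0)
      (by simpa only [hby] using hy)
  have hA : -(b 0 * b 1) ≠ 0 := neg_ne_zero.2 (mul_ne_zero (hb 0) (hb 1))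
  have hC : -(b 2 * b 3) ≠ 0 := neg_ne_zero.2 (mul_ne_zero (hb 2) (hb 3))
  have hb2 : -b 2 ≠ 0 := neg_ne_zero.2 (hb 2)
  obtain ⟨t, ht, hsym⟩ := exists_tameSymbol_eq_one hE hA hC (hb 0) hb2
    (fun p hp _ => by
      obtain ⟨v, hv, hvp⟩ := exists_valuation_of_irreducible hp
      obtain ⟨y, hy0, hy⟩ := hval v hv
      exact ⟨_, hy0, tameSymbol_common_value hp hb hy0 (hvp _ _ hy)⟩)
    (by
      obtain ⟨v, hv, hvd⟩ := exists_valuation_degree (E := E)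
      obtain ⟨y, hy0, hy⟩ := hval v hv
      exact ⟨_, hy0, tameSymbolInfty_common_value hE hb hy0 (hvd _ _ hy)⟩)
  exact isotropicDiag_of_polynomial hd hab (isotropicDiag_of_isNormSolvable hb ht
    (isNormSolvable_of_tameSymbol hE hA (mul_ne_zero (hb 0) ht) fun p hp hm => (hsym p hp hm).1)
    (isNormSolvable_of_tameSymbol hE hC (mul_ne_zero hb2 ht) fun p hp hm => (hsym p hp hm).2))
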